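/- arXiv:1402.0290 — 7 statements merged into one kernel-verified Lean document; each statement's English description precedes it below -/
import Mathlib

section
/- Let λ > 1, 0 < α < 1/2, and 0 < δ < 1 − 2α. Then there exists a natural number n₀, a strictly increasing sequence of times 0 = t_{n₀} < t_{n₀+1} < t_{n₀+2} < ⋯ converging to a finite limit T*, and continuous, piecewise smooth functions X_n : [0, T*) → ℝ for n ≥ n₀ such that: X_{n₀+k}(t) = 0 whenever k ≥ 1 and 0 ≤ t ≤ t_{n₀+k−1}; for all t ∈ [0, T*) other than the times t_{n₀}, t_{n₀+1}, …, and all n ≥ n₀ (with the conventions t_{n₀−1} = 0 and X_{n₀−1} ≡ 0), one has ∂ₜX_n = −λ^{2nα} X_n + 1_{(t_{n−1},t_n)}(t) λ^{n−1} X_{n−1}² − 1_{(t_n,t_{n+1})}(t) λ^n X_n X_{n+1}; and X_{n₀+k}(t_{n₀+k}) = λ^{−δk} for every k ≥ 0. In particular, for any δ′ > δ one has limsup_{t→T*} sup_n λ^{δ′n} |X_n(t)| = +∞. -/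
open Set

theorem exists_hasDerivWithinAt_of_hasCompactSupport {E : Type*} [NormedAddCommGroup E]
    [NormedSpace ℝ E] [CompleteSpace E] {F : E → E} (hF : ContDiff ℝ 1 F)
    (hc : HasCompactSupport F) (x₀ : E) {S : ℝ} (hS : 0 ≤ S) :
    ∃ γ : ℝ → E, γ 0 = x₀ ∧ ∀ s ∈ Icc 0 S, HasDerivWithinAt γ (F (γ s)) (Icc 0 S) s := by
  obtain ⟨K, hK⟩ := ContDiff.lipschitzWith_of_hasCompactSupport hc hF one_ne_zero
  obtain ⟨C, hC⟩ := hc.exists_bound_of_continuous hF.continuous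
  have hC0 : 0 ≤ C := (norm_nonneg _).trans (hC x₀)
  have h : IsPicardLindelof (fun _ : ℝ => F) (tmin := 0) (tmax := S) ⟨0, by simp [hS]⟩ x₀
      ⟨C * S, by positivity⟩ 0 ⟨C, hC0⟩ K := by
    refine IsPicardLindelof.of_time_independent (fun x _ => hC x) hK.lipschitzOnWith ?_
    change C * max (S - 0) (0 - 0) ≤ C * S - 0
    simp [hS]
  exact h.exists_eq_forall_mem_Icc_hasDerivWithinAt₀

theorem exists_damped_quadratic_system {ε₁ ε₂ : ℝ} (h₁ : 0 ≤ ε₁) (h₂ : 0 ≤ ε₂) {S : ℝ}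
    (hS : 0 ≤ S) :
    ∃ u v : ℝ → ℝ, u 0 = 1 ∧ v 0 = 0 ∧
      (∀ s ∈ Icc 0 S, u s ^ 2 + v s ^ 2 ≤ 1) ∧
      (∀ s ∈ Icc 0 S, HasDerivWithinAt u (-ε₁ * u s - u s * v s) (Icc 0 S) s) ∧
      (∀ s ∈ Icc 0 S, HasDerivWithinAt v (-ε₂ * v s + u s ^ 2) (Icc 0 S) s) ∧
      ContDiffOn ℝ (⊤ : ℕ∞) u (Icc 0 S) ∧ ContDiffOn ℝ (⊤ : ℕ∞) v (Icc 0 S) := by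
  let χ : ContDiffBump (0 : ℝ × ℝ) := ⟨1, 2, one_pos, one_lt_two⟩
  let G : ℝ × ℝ → ℝ × ℝ := fun p => (-ε₁ * p.1 - p.1 * p.2, -ε₂ * p.2 + p.1 ^ 2)
  let F : ℝ × ℝ → ℝ × ℝ := fun p => χ p • G p
  have hG : ∀ n : WithTop ℕ∞, ContDiff ℝ n G := fun n => by
    refine ContDiff.prodMk ?_ ?_ <;> fun_prop
  have hF : ∀ n : ℕ∞, ContDiff ℝ n F := fun n => χ.contDiff.smul (hG n)
  have hFc : HasCompactSupport F := χ.hasCompactSupport.smul_right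
  obtain ⟨γ, hγ0, hγ⟩ := exists_hasDerivWithinAt_of_hasCompactSupport (hF 1) hFc (1, 0) hS
  have hu : ∀ s ∈ Icc 0 S, HasDerivWithinAt (fun s => (γ s).1) (F (γ s)).1 (Icc 0 S) s :=
    fun s hs => (hγ s hs).fst
  have hv : ∀ s ∈ Icc 0 S, HasDerivWithinAt (fun s => (γ s).2) (F (γ s)).2 (Icc 0 S) s :=
    fun s hs => (hγ s hs).snd
  have hE : ∀ s ∈ Icc 0 S, HasDerivWithinAt (fun s => (γ s).1 ^ 2 + (γ s).2 ^ 2)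
      (-2 * χ (γ s) * (ε₁ * (γ s).1 ^ 2 + ε₂ * (γ s).2 ^ 2)) (Icc 0 S) s := fun s hs => by
    refine (((hu s hs).pow 2).add ((hv s hs).pow 2)).congr_deriv ?_
    simp only [F, G, Prod.smul_mk, smul_eq_mul]
    push_cast
    ring
  have hle : ∀ s ∈ Icc 0 S, (γ s).1 ^ 2 + (γ s).2 ^ 2 ≤ 1 := fun s hs => by
    have := antitoneOn_of_hasDerivWithinAt_nonpos (convex_Icc 0 S)
      (fun s hs => (hE s hs).continuousWithinAt)
      (fun s hs => (hE s (interior_subset hs)).mono interior_subset)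
      (fun s _ => by
        have := χ.nonneg (x := γ s)
        have : 0 ≤ χ (γ s) * (ε₁ * (γ s).1 ^ 2 + ε₂ * (γ s).2 ^ 2) := by positivity
        linarith) (left_mem_Icc.2 hS) hs hs.1
    simpa [hγ0] using this
  have hFG : ∀ s ∈ Icc 0 S, F (γ s) = G (γ s) := fun s hs => by
    have h := hle s hs
    have : χ (γ s) = 1 := by
      refine χ.one_of_mem_closedBall ?_
      rw [mem_closedBall_zero_iff, Prod.norm_def]
      refine max_le ?_ ?_ <;> rw [Real.norm_eq_abs, ← sq_le_one_iff_abs_le_one]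
      · nlinarith [sq_nonneg (γ s).2]
      · nlinarith [sq_nonneg (γ s).1]
    simp [F, this]
  have hsm : ContDiffOn ℝ (⊤ : ℕ∞) γ (Icc 0 S) :=
    ODE.contDiffOn_enat_Icc_of_hasDerivWithinAt (f := fun _ => F) (u := univ)
      ((hF ⊤).comp contDiff_snd).contDiffOn hγ (mapsTo_univ _ _)
  refine ⟨fun s => (γ s).1, fun s => (γ s).2, by simp [hγ0], by simp [hγ0], hle, ?_, ?_,
    hsm.fst, hsm.snd⟩
  · intro s hs
    simpa only [hFG s hs] using hu s hs
  · intro s hs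
    simpa only [hFG s hs] using hv s hs

theorem exists_damped_quadratic_system_hitting {θ : ℝ} (hθ0 : 0 < θ) (hθ1 : θ < 1) :
    ∃ S > 0, ∃ ε₀ > 0, ∀ ε₁ ε₂ : ℝ, 0 ≤ ε₁ → ε₁ ≤ ε₂ → ε₂ ≤ ε₀ →
      ∃ (u v : ℝ → ℝ) (τ : ℝ), 0 < τ ∧ τ ≤ S ∧ u 0 = 1 ∧ v 0 = 0 ∧ v τ = θ ∧
        ContinuousOn u (Icc 0 τ) ∧ ContinuousOn v (Icc 0 τ) ∧
        ContDiffOn ℝ (⊤ : ℕ∞) u (Ioo 0 τ) ∧ ContDiffOn ℝ (⊤ : ℕ∞) v (Ioo 0 τ) ∧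
        (∀ s ∈ Ioo 0 τ, HasDerivAt u (-ε₁ * u s - u s * v s) s) ∧
        (∀ s ∈ Ioo 0 τ, HasDerivAt v (-ε₂ * v s + u s ^ 2) s) := by
  obtain ⟨c, hc⟩ : ∃ c, c = (1 - θ ^ 2) / 2 := ⟨_, rfl⟩
  have hc0 : 0 < c := by nlinarith
  obtain ⟨S, hSdef⟩ : ∃ S, S = 4 * θ / c := ⟨_, rfl⟩
  have hS : 0 < S := by rw [hSdef]; positivity
  have hcS : c * S = 4 * θ := by rw [hSdef]; field_simp
  refine ⟨S, hS, min (c / (2 * S)) (c / 2), by positivity, fun ε₁ ε₂ h₁ h₁₂ hε => ?_⟩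
  have h₂ : 0 ≤ ε₂ := h₁.trans h₁₂
  have hεS : 2 * ε₂ * S ≤ c := by
    have := hε.trans (min_le_left _ _)
    rw [le_div_iff₀ (by positivity)] at this
    linarith
  have hεθ : ε₂ ≤ c / 2 := hε.trans (min_le_right _ _)
  obtain ⟨u, v, hu0, hv0, hle, hu, hv, hus, hvs⟩ := exists_damped_quadratic_system h₁ h₂ hS.le
  have hcont : ContinuousOn v (Icc 0 S) := hvs.continuousOn
  have hlow : ∀ s ∈ Icc 0 S, 1 - c ≤ u s ^ 2 + v s ^ 2 := fun s hs => by
    have hE : ∀ s ∈ Icc 0 S, HasDerivWithinAt (fun s => u s ^ 2 + v s ^ 2 + 2 * ε₂ * s)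
        (-2 * (ε₁ * u s ^ 2 + ε₂ * v s ^ 2) + 2 * ε₂) (Icc 0 S) s := fun s hs => by
      refine ((((hu s hs).pow 2).add ((hv s hs).pow 2)).add
        ((hasDerivWithinAt_id _ _).const_mul (2 * ε₂))).congr_deriv ?_
      push_cast
      ring
    have := monotoneOn_of_hasDerivWithinAt_nonneg (convex_Icc 0 S)
      (fun s hs => (hE s hs).continuousWithinAt)
      (fun s hs => (hE s (interior_subset hs)).mono interior_subset)
      (fun s hs => by
        have := hle s (interior_subset hs)
        nlinarith [sq_nonneg (u s), sq_nonneg (v s),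
          mul_le_mul_of_nonneg_right h₁₂ (sq_nonneg (u s))])
      (left_mem_Icc.2 hS.le) hs hs.1
    simp only [hu0, hv0] at this
    nlinarith [hs.2, mul_le_mul_of_nonneg_left hs.2 h₂]
  have hvnn : ∀ s ∈ Icc 0 S, 0 ≤ v s := fun s hs => by
    have hE : ∀ s ∈ Icc 0 S, HasDerivWithinAt (fun s => Real.exp (ε₂ * s) * v s)
        (Real.exp (ε₂ * s) * u s ^ 2) (Icc 0 S) s := fun s hs => by
      refine ((((hasDerivWithinAt_id s _).const_mul ε₂).exp).mul (hv s hs)).congr_deriv ?_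
      simp only [id]
      ring
    have := monotoneOn_of_hasDerivWithinAt_nonneg (convex_Icc 0 S)
      (fun s hs => (hE s hs).continuousWithinAt)
      (fun s hs => (hE s (interior_subset hs)).mono interior_subset)
      (fun s hs => by positivity) (left_mem_Icc.2 hS.le) hs hs.1
    simp only [hv0, mul_zero] at this
    exact nonneg_of_mul_nonneg_right this (Real.exp_pos _)
  obtain ⟨r, hr, hrθ⟩ : ∃ r ∈ Icc 0 S, θ ≤ v r := by
    by_contra! hlt
    have hE : ∀ s ∈ Icc 0 S, HasDerivWithinAt (fun s => v s - c / 2 * s)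
        (-ε₂ * v s + u s ^ 2 - c / 2) (Icc 0 S) s := fun s hs => by
      refine ((hv s hs).sub ((hasDerivWithinAt_id s _).const_mul (c / 2))).congr_deriv ?_
      ring
    have := monotoneOn_of_hasDerivWithinAt_nonneg (convex_Icc 0 S)
      (fun s hs => (hE s hs).continuousWithinAt)
      (fun s hs => (hE s (interior_subset hs)).mono interior_subset)
      (fun s hs => by
        have hs' := interior_subset hs
        have h1 := hlow s hs'
        have h2 := hvnn s hs'
        have h3 := hlt s hs'
        nlinarith [mul_le_mul hεθ (h3.le.trans hθ1.le) h2 (by positivity)])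
      (left_mem_Icc.2 hS.le) (right_mem_Icc.2 hS.le) hS.le
    simp only [hv0] at this
    linarith [hlt S (right_mem_Icc.2 hS.le)]
  obtain ⟨τ, hτ, hτθ⟩ := intermediate_value_Icc hr.1 (hcont.mono (Icc_subset_Icc_right hr.2))
    (show θ ∈ Icc (v 0) (v r) from ⟨by rw [hv0]; exact hθ0.le, hrθ⟩)
  have hτ0 : 0 < τ := hτ.1.lt_of_ne (by rintro rfl; rw [hv0] at hτθ; exact hθ0.ne hτθ)
  have hτS : τ ≤ S := hτ.2.trans hr.2
  have hsub : Icc 0 τ ⊆ Icc 0 S := Icc_subset_Icc_right hτS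
  have hsub' : Ioo 0 τ ⊆ Icc 0 S := Ioo_subset_Icc_self.trans hsub
  have hn : ∀ s ∈ Ioo 0 τ, Icc 0 S ∈ nhds s := fun s hs =>
    Icc_mem_nhds hs.1 (hs.2.trans_le hτS)
  exact ⟨u, v, τ, hτ0, hτS, hu0, hv0, hτθ, hus.continuousOn.mono hsub, hcont.mono hsub,
    hus.mono hsub', hvs.mono hsub', fun s hs => (hu s (hsub' hs)).hasDerivAt (hn s hs),
    fun s hs => (hv s (hsub' hs)).hasDerivAt (hn s hs)⟩

/-- For small damping, a mode started at amplitude `A` passes amplitude `θ * A` to the next mode,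
initially at rest, within a time comparable to `1 / (g * A)`. -/
theorem exists_pair_transfer {θ : ℝ} (hθ0 : 0 < θ) (hθ1 : θ < 1) :
    ∃ S > 0, ∃ ε₀ > 0, ∀ d₁ d₂ g A : ℝ, 0 ≤ d₁ → d₁ ≤ d₂ → 0 < g → 0 < A → d₂ ≤ ε₀ * (g * A) →
      ∃ τ : ℝ, 0 < τ ∧ τ ≤ S / (g * A) ∧ ∀ a : ℝ, ∃ U V : ℝ → ℝ,
        U a = A ∧ V a = 0 ∧ V (a + τ) = θ * A ∧
        ContinuousOn U (Icc a (a + τ)) ∧ ContinuousOn V (Icc a (a + τ)) ∧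
        ContDiffOn ℝ (⊤ : ℕ∞) U (Ioo a (a + τ)) ∧ ContDiffOn ℝ (⊤ : ℕ∞) V (Ioo a (a + τ)) ∧
        (∀ s ∈ Ioo a (a + τ), HasDerivAt U (-d₁ * U s - g * U s * V s) s) ∧
        (∀ s ∈ Ioo a (a + τ), HasDerivAt V (-d₂ * V s + g * U s ^ 2) s) := by
  obtain ⟨S, hS, ε₀, hε₀, H⟩ := exists_damped_quadratic_system_hitting hθ0 hθ1
  refine ⟨S, hS, ε₀, hε₀, fun d₁ d₂ g A h₁ h₁₂ hg hA hd => ?_⟩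
  have hgA : 0 < g * A := mul_pos hg hA
  obtain ⟨u, v, τ, hτ0, hτS, hu0, hv0, hvτ, huc, hvc, hus, hvs, hu, hv⟩ :=
    H (d₁ / (g * A)) (d₂ / (g * A)) (by positivity) (by gcongr) (by rwa [div_le_iff₀ hgA])
  refine ⟨τ / (g * A), by positivity, by gcongr, fun a => ?_⟩
  have hIcc : MapsTo (fun s => g * A * (s - a)) (Icc a (a + τ / (g * A))) (Icc 0 τ) := by
    intro s hs
    refine ⟨mul_nonneg hgA.le (sub_nonneg.2 hs.1), ?_⟩
    have : s - a ≤ τ / (g * A) := by linarith [hs.2]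
    rw [le_div_iff₀ hgA] at this
    linarith
  have hIoo : MapsTo (fun s => g * A * (s - a)) (Ioo a (a + τ / (g * A))) (Ioo 0 τ) := by
    intro s hs
    refine ⟨mul_pos hgA (sub_pos.2 hs.1), ?_⟩
    have : s - a < τ / (g * A) := by linarith [hs.2]
    rw [lt_div_iff₀ hgA] at this
    linarith
  have hd : ∀ s, HasDerivAt (fun s => g * A * (s - a)) (g * A) s := fun s => by
    simpa using ((hasDerivAt_id s).sub_const a).const_mul (g * A)
  have hsm : ∀ B : Set ℝ, ContDiffOn ℝ (⊤ : ℕ∞) (fun s => g * A * (s - a)) B := fun B => by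
    fun_prop
  have hct : ∀ B : Set ℝ, ContinuousOn (fun s => g * A * (s - a)) B := fun B => by fun_prop
  refine ⟨fun s => A * u (g * A * (s - a)), fun s => A * v (g * A * (s - a)), by simp [hu0],
    by simp [hv0], ?_, (huc.comp (hct _) hIcc).const_mul A,
    (hvc.comp (hct _) hIcc).const_mul A, contDiffOn_const.mul (hus.comp (hsm _) hIoo),
    contDiffOn_const.mul (hvs.comp (hsm _) hIoo), fun s hs => ?_, fun s hs => ?_⟩
  · have : g * A * (a + τ / (g * A) - a) = τ := by field_simp; ring
    simp only [this, hvτ, mul_comm]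
  · refine (((hu _ (hIoo hs)).comp s (hd s)).const_mul A).congr_deriv ?_
    field_simp
  · refine (((hv _ (hIoo hs)).comp s (hd s)).const_mul A).congr_deriv ?_
    field_simp

/-- Mode `k` of the truncated system: zero up to `t (k - 1)`, then driven by mode `k - 1` (along
`V (k - 1)`) up to `t k`, then driving mode `k + 1` (along `U k`) up to `t (k + 1)`, and freely
decaying at rate `d k` afterwards. -/
noncomputable def gluedMode (t : ℕ → ℝ) (U V : ℕ → ℝ → ℝ) (d : ℕ → ℝ) : ℕ → ℝ → ℝ
  | 0, s => if s ≤ t 1 then U 0 s else U 0 (t 1) * Real.exp (-d 0 * (s - t 1))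
  | k + 1, s =>
    if s ≤ t k then 0
    else if s ≤ t (k + 1) then V k s
    else if s ≤ t (k + 2) then U (k + 1) s
    else U (k + 1) (t (k + 2)) * Real.exp (-d (k + 1) * (s - t (k + 2)))

section gluedMode

variable {t : ℕ → ℝ} {U V : ℕ → ℝ → ℝ} {d : ℕ → ℝ}

theorem gluedMode_succ_of_le {k : ℕ} {s : ℝ} (h : s ≤ t k) :
    gluedMode t U V d (k + 1) s = 0 := by
  simp [gluedMode, h]

theorem gluedMode_succ_of_mem_Icc (hV0 : ∀ k, V k (t k) = 0) {k : ℕ} {s : ℝ}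
    (hs : s ∈ Icc (t k) (t (k + 1))) : gluedMode t U V d (k + 1) s = V k s := by
  rcases hs.1.eq_or_lt with h | h
  · rw [gluedMode_succ_of_le h.ge, ← h, hV0]
  · simp [gluedMode, h.not_ge, hs.2]

theorem gluedMode_of_mem_Icc (ht : StrictMono t) (hV0 : ∀ k, V k (t k) = 0)
    (hVU : ∀ k, V k (t (k + 1)) = U (k + 1) (t (k + 1))) {k : ℕ} {s : ℝ}
    (hs : s ∈ Icc (t k) (t (k + 1))) : gluedMode t U V d k s = U k s := by
  rcases k with _ | k
  · have : s ≤ t 1 := hs.2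
    simp [gluedMode, this]
  · rcases hs.1.eq_or_lt with h | h
    · rw [← h, gluedMode_succ_of_mem_Icc hV0 (right_mem_Icc.2 (ht k.lt_succ_self).le), hVU]
    · have h' : t k < s := (ht k.lt_succ_self).trans h
      have h2 : s ≤ t (k + 2) := hs.2
      simp [gluedMode, h.not_ge, h'.not_ge, h2]

theorem gluedMode_of_ge (ht : StrictMono t) (hV0 : ∀ k, V k (t k) = 0)
    (hVU : ∀ k, V k (t (k + 1)) = U (k + 1) (t (k + 1))) {k : ℕ} {s : ℝ}
    (hs : t (k + 1) ≤ s) :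
    gluedMode t U V d k s = U k (t (k + 1)) * Real.exp (-d k * (s - t (k + 1))) := by
  rcases hs.eq_or_lt with h | h
  · rw [← h, gluedMode_of_mem_Icc ht hV0 hVU (right_mem_Icc.2 (ht k.lt_succ_self).le)]
    simp
  · rcases k with _ | k
    · have : t 1 < s := h
      simp [gluedMode, this.not_ge]
    · have h2 : t (k + 2) < s := h
      have h1 : t (k + 1) < s := (ht k.succ.lt_succ_self).trans h
      have h0 : t k < s := (ht k.lt_succ_self).trans h1
      simp [gluedMode, h0.not_ge, h1.not_ge, h2.not_ge]

end gluedMode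

theorem gluedMode_spec {t : ℕ → ℝ} {U V : ℕ → ℝ → ℝ} {d g : ℕ → ℝ} (ht : StrictMono t)
    (hV0 : ∀ k, V k (t k) = 0) (hVU : ∀ k, V k (t (k + 1)) = U (k + 1) (t (k + 1)))
    (hUc : ∀ k, ContinuousOn (U k) (Icc (t k) (t (k + 1))))
    (hVc : ∀ k, ContinuousOn (V k) (Icc (t k) (t (k + 1))))
    (hUs : ∀ k, ContDiffOn ℝ (⊤ : ℕ∞) (U k) (Ioo (t k) (t (k + 1))))
    (hVs : ∀ k, ContDiffOn ℝ (⊤ : ℕ∞) (V k) (Ioo (t k) (t (k + 1))))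
    (hU : ∀ k, ∀ s ∈ Ioo (t k) (t (k + 1)),
      HasDerivAt (U k) (-d k * U k s - g k * U k s * V k s) s)
    (hV : ∀ k, ∀ s ∈ Ioo (t k) (t (k + 1)),
      HasDerivAt (V k) (-d (k + 1) * V k s + g k * U k s ^ 2) s) (k j : ℕ) :
    ContinuousOn (gluedMode t U V d k) (Icc (t j) (t (j + 1))) ∧
    ContDiffOn ℝ (⊤ : ℕ∞) (gluedMode t U V d k) (Ioo (t j) (t (j + 1))) ∧
    ∀ s ∈ Ioo (t j) (t (j + 1)), HasDerivAt (gluedMode t U V d k)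
      (-d k * gluedMode t U V d k s +
        (if 1 ≤ k ∧ t (k - 1) < s ∧ s < t k then
          g (k - 1) * gluedMode t U V d (k - 1) s ^ 2 else 0) -
        (if t k < s ∧ s < t (k + 1) then
          g k * gluedMode t U V d k s * gluedMode t U V d (k + 1) s else 0)) s := by
  suffices key : ∃ Y : ℝ → ℝ, EqOn (gluedMode t U V d k) Y (Icc (t j) (t (j + 1))) ∧
      ContinuousOn Y (Icc (t j) (t (j + 1))) ∧ ContDiffOn ℝ (⊤ : ℕ∞) Y (Ioo (t j) (t (j + 1))) ∧
      ∀ s ∈ Ioo (t j) (t (j + 1)), HasDerivAt Y (-d k * gluedMode t U V d k s +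
        (if 1 ≤ k ∧ t (k - 1) < s ∧ s < t k then
          g (k - 1) * gluedMode t U V d (k - 1) s ^ 2 else 0) -
        (if t k < s ∧ s < t (k + 1) then
          g k * gluedMode t U V d k s * gluedMode t U V d (k + 1) s else 0)) s by
    obtain ⟨Y, hY, hc, hs, hd⟩ := key
    exact ⟨hc.congr hY, hs.congr (hY.mono Ioo_subset_Icc_self), fun s hs =>
      (hd s hs).congr_of_eventuallyEq
        (Filter.eventuallyEq_of_mem (Icc_mem_nhds hs.1 hs.2) hY)⟩
  rcases lt_trichotomy j k with hjk | rfl | hjk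
  · obtain ⟨k, rfl⟩ : ∃ i, k = i + 1 := ⟨k - 1, by omega⟩
    rcases (Nat.lt_succ_iff.1 hjk).eq_or_lt with rfl | hjk'
    · refine ⟨V j, fun s hs => gluedMode_succ_of_mem_Icc hV0 hs, hVc j, hVs j,
        fun s hs => ?_⟩
      have hs' := Ioo_subset_Icc_self hs
      refine (hV j s hs).congr_deriv ?_
      have hnot : ¬(t (j + 1) < s ∧ s < t (j + 1 + 1)) := fun h => hs.2.not_gt h.1
      rw [if_neg hnot, if_pos ⟨by omega, hs.1, hs.2⟩, gluedMode_succ_of_mem_Icc hV0 hs',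
        Nat.add_sub_cancel, gluedMode_of_mem_Icc ht hV0 hVU hs']
      ring
    · refine ⟨fun _ => 0, fun s hs => gluedMode_succ_of_le
        (hs.2.trans (ht.monotone hjk')), continuousOn_const, contDiffOn_const, fun s hs => ?_⟩
      refine (hasDerivAt_const s (0 : ℝ)).congr_deriv ?_
      have hsk : s < t k := hs.2.trans_le (ht.monotone hjk')
      have hnot₁ : ¬(1 ≤ k + 1 ∧ t (k + 1 - 1) < s ∧ s < t (k + 1)) :=
        fun h => hsk.not_gt h.2.1
      have hnot₂ : ¬(t (k + 1) < s ∧ s < t (k + 1 + 1)) :=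
        fun h => ((ht k.lt_succ_self).trans h.1).not_gt hsk
      rw [if_neg hnot₁, if_neg hnot₂, gluedMode_succ_of_le (hs.2.le.trans (ht.monotone hjk'))]
      simp
  · refine ⟨U j, fun s hs => gluedMode_of_mem_Icc ht hV0 hVU hs, hUc j, hUs j,
      fun s hs => ?_⟩
    have hs' := Ioo_subset_Icc_self hs
    refine (hU j s hs).congr_deriv ?_
    have hnot : ¬(1 ≤ j ∧ t (j - 1) < s ∧ s < t j) := fun h => hs.1.not_gt h.2.2
    rw [if_neg hnot, if_pos ⟨hs.1, hs.2⟩, gluedMode_succ_of_mem_Icc hV0 hs',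
      gluedMode_of_mem_Icc ht hV0 hVU hs']
    ring
  · refine ⟨fun s => U k (t (k + 1)) * Real.exp (-d k * (s - t (k + 1))),
      fun s hs => gluedMode_of_ge ht hV0 hVU ((ht.monotone hjk).trans hs.1),
      by fun_prop, by fun_prop, fun s hs => ?_⟩
    have hks : t (k + 1) < s := (ht.monotone hjk).trans_lt hs.1
    have hnot₁ : ¬(1 ≤ k ∧ t (k - 1) < s ∧ s < t k) :=
      fun h => ((ht k.lt_succ_self).trans hks).not_gt h.2.2
    have hnot₂ : ¬(t k < s ∧ s < t (k + 1)) := fun h => hks.not_gt h.2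
    rw [if_neg hnot₁, if_neg hnot₂,
      gluedMode_of_ge ht hV0 hVU ((ht.monotone hjk).trans hs.1.le)]
    refine ((((hasDerivAt_id s).sub_const (t (k + 1))).const_mul (-d k)).exp.const_mul
      (U k (t (k + 1)))).congr_deriv ?_
    simp only [id]
    ring

theorem exists_mem_Ico_succ_of_lt {t : ℕ → ℝ} {s : ℝ} (h0 : t 0 ≤ s) {n : ℕ} (hn : s < t n) :
    ∃ j, s ∈ Ico (t j) (t (j + 1)) := by
  induction n with
  | zero => exact absurd hn h0.not_gt
  | succ n ih =>
    rcases lt_or_ge s (t n) with h | h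
    · exact ih h
    · exact ⟨n, h, hn⟩

theorem continuousOn_Ico_of_forall_Icc_succ {t : ℕ → ℝ} {T : ℝ} (ht : Monotone t)
    (hT : Filter.Tendsto t Filter.atTop (nhds T)) {f : ℝ → ℝ}
    (hf : ∀ j, ContinuousOn f (Icc (t j) (t (j + 1)))) : ContinuousOn f (Ico (t 0) T) := by
  have hIcc : ∀ n, ContinuousOn f (Icc (t 0) (t n)) := fun n => by
    induction n with
    | zero => simp
    | succ n ih =>
      rw [← Icc_union_Icc_eq_Icc (ht n.zero_le) (ht n.le_succ)]
      exact ih.union_of_isClosed (hf n) isClosed_Icc isClosed_Icc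
  intro s hs
  obtain ⟨n, hn⟩ := (hT.eventually (lt_mem_nhds hs.2)).exists
  refine (hIcc n s ⟨hs.1, hn.le⟩).mono_of_mem_nhdsWithin ?_
  filter_upwards [self_mem_nhdsWithin, mem_nhdsWithin_of_mem_nhds (Iio_mem_nhds hn)] with x hx hx'
  exact ⟨hx.1, le_of_lt hx'⟩

/-- Finite time blowup for the exogenously truncated dyadic (Katz–Pavlović type) model:
for `λ > 1`, `0 < α < 1/2`, `0 < δ < 1 - 2α`, there is `n₀`, an increasing sequence of
times `t_{n₀+k}` converging to a finite time `T`, and continuous piecewise smooth functions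
`X_{n₀+k}` (indexed here by `k : ℕ`) solving the truncated system, vanishing before
activation, with `X_{n₀+k}(t_{n₀+k}) = λ^{-δk}`, and blowing up at `T` faster than any
`λ^{-δ' n}` decay with `δ' > δ`. -/
theorem truncated_dyadic_blowup (lam α δ : ℝ) (hlam : 1 < lam)
    (hα0 : 0 < α) (hα : α < 1 / 2) (hδ0 : 0 < δ) (hδ : δ < 1 - 2 * α) :
    ∃ (n₀ : ℕ) (T : ℝ) (t : ℕ → ℝ) (X : ℕ → ℝ → ℝ),
      t 0 = 0 ∧
      StrictMono t ∧
      (∀ k : ℕ, t k < T) ∧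
      Filter.Tendsto t Filter.atTop (nhds T) ∧
      (∀ k : ℕ, ContinuousOn (X k) (Set.Ico 0 T)) ∧
      (∀ k j : ℕ, ContDiffOn ℝ (⊤ : ℕ∞) (X k) (Set.Ioo (t j) (t (j + 1)))) ∧
      (∀ k : ℕ, 1 ≤ k → ∀ s : ℝ, 0 ≤ s → s ≤ t (k - 1) → X k s = 0) ∧
      (∀ k : ℕ, ∀ s : ℝ, 0 ≤ s → s < T → (∀ j : ℕ, s ≠ t j) →
        HasDerivAt (X k)
          (-lam ^ (2 * ((n₀ : ℝ) + k) * α) * X k s +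
            (if 1 ≤ k ∧ t (k - 1) < s ∧ s < t k then
              lam ^ ((n₀ : ℝ) + k - 1) * X (k - 1) s ^ 2 else 0) -
            (if t k < s ∧ s < t (k + 1) then
              lam ^ ((n₀ : ℝ) + k) * X k s * X (k + 1) s else 0)) s) ∧
      (∀ k : ℕ, X k (t k) = lam ^ (-(δ * (k : ℝ)))) ∧
      (∀ δ' : ℝ, δ < δ' → ∀ M : ℝ, ∀ s₀ : ℝ, s₀ < T →
        ∃ s : ℝ, s₀ ≤ s ∧ s < T ∧ ∃ k : ℕ,
          M < lam ^ (δ' * ((n₀ : ℝ) + k)) * |X k s|) := by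
  have hlam0 : 0 < lam := one_pos.trans hlam
  have hθ1 : lam ^ (-δ) < 1 := Real.rpow_lt_one_of_one_lt_of_neg hlam (by linarith)
  obtain ⟨S, hS, ε₀, hε₀, H⟩ := exists_pair_transfer (Real.rpow_pos_of_pos hlam0 (-δ)) hθ1
  obtain ⟨n₀, hn₀⟩ : ∃ n₀ : ℕ, lam ^ (2 * α - (1 - 2 * α) * n₀) ≤ ε₀ := by
    obtain ⟨n, hn⟩ := exists_pow_lt_of_lt_one
      (show 0 < ε₀ / lam ^ (2 * α) by positivity)
      (Real.rpow_lt_one_of_one_lt_of_neg hlam (show -(1 - 2 * α) < 0 by linarith))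
    refine ⟨n, ?_⟩
    rw [lt_div_iff₀ (by positivity), ← Real.rpow_mul_natCast hlam0.le,
      ← Real.rpow_add hlam0] at hn
    refine le_trans (le_of_eq ?_) hn.le
    congr 1
    ring
  let d : ℕ → ℝ := fun k => lam ^ (2 * ((n₀ : ℝ) + k) * α)
  let g : ℕ → ℝ := fun k => lam ^ ((n₀ : ℝ) + k)
  let A : ℕ → ℝ := fun k => lam ^ (-(δ * (k : ℝ)))
  have hd0 : ∀ k, 0 < d k := fun k => Real.rpow_pos_of_pos hlam0 _
  have hg0 : ∀ k, 0 < g k := fun k => Real.rpow_pos_of_pos hlam0 _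
  have hA0 : ∀ k, 0 < A k := fun k => Real.rpow_pos_of_pos hlam0 _
  have hdd : ∀ k, d k ≤ d (k + 1) := fun k => by
    refine Real.rpow_le_rpow_of_exponent_le hlam.le ?_
    push_cast
    nlinarith
  have hdg : ∀ k, d (k + 1) ≤ ε₀ * (g k * A k) := fun k => by
    calc d (k + 1) ≤ lam ^ (2 * α - (1 - 2 * α) * n₀ + ((n₀ : ℝ) + k + -(δ * (k : ℝ)))) := by
          refine Real.rpow_le_rpow_of_exponent_le hlam.le ?_
          push_cast
          nlinarith [mul_nonneg (sub_nonneg.2 hδ.le) (Nat.cast_nonneg (α := ℝ) k)]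
      _ = lam ^ (2 * α - (1 - 2 * α) * n₀) * (g k * A k) := by
          rw [Real.rpow_add hlam0, Real.rpow_add hlam0 (_ + _)]
      _ ≤ ε₀ * (g k * A k) :=
          mul_le_mul_of_nonneg_right hn₀ (mul_pos (hg0 k) (hA0 k)).le
  have hAA : ∀ k, lam ^ (-δ) * A k = A (k + 1) := fun k => by
    simp only [A]
    rw [← Real.rpow_add hlam0]
    congr 1
    push_cast
    ring
  choose τ hτ0 hτS W using fun k => H (d k) (d (k + 1)) (g k) (A k) (hd0 k).le (hdd k)
    (hg0 k) (hA0 k) (hdg k)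
  have hsum : Summable τ := by
    have hr1 : lam ^ (-(1 - δ)) < 1 :=
      Real.rpow_lt_one_of_one_lt_of_neg hlam (by linarith)
    refine Summable.of_nonneg_of_le (fun k => (hτ0 k).le) (fun k => ?_)
      ((summable_geometric_of_lt_one (by positivity) hr1).mul_left S)
    refine (hτS k).trans ?_
    rw [div_eq_mul_inv]
    refine mul_le_mul_of_nonneg_left ?_ hS.le
    simp only [g, A]
    rw [← Real.rpow_add hlam0, ← Real.rpow_neg hlam0.le, ← Real.rpow_mul_natCast hlam0.le]
    refine Real.rpow_le_rpow_of_exponent_le hlam.le ?_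
    nlinarith [Nat.cast_nonneg (α := ℝ) n₀]
  obtain ⟨t, htdef⟩ : ∃ t : ℕ → ℝ, t = fun k => ∑ i ∈ Finset.range k, τ i := ⟨_, rfl⟩
  have ht0 : t 0 = 0 := by simp [htdef]
  have hts : ∀ k, t (k + 1) = t k + τ k := fun k => by simp [htdef, Finset.sum_range_succ]
  have ht : StrictMono t := strictMono_nat_of_lt_succ fun k => by linarith [hts k, hτ0 k]
  have htT : Filter.Tendsto t Filter.atTop (nhds (∑' i, τ i)) := by
    rw [htdef]
    exact hsum.hasSum.tendsto_sum_nat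
  have hlt : ∀ k, t k < ∑' i, τ i := fun k =>
    (ht k.lt_succ_self).trans_le (ht.monotone.ge_of_tendsto htT _)
  choose U V hUA hV0 hVθ hUc hVc hUs hVs hU hV using fun k => W k (t k)
  simp only [← hts] at hVθ hUc hVc hUs hVs hU hV
  have hVU : ∀ k, V k (t (k + 1)) = U (k + 1) (t (k + 1)) := fun k => by
    rw [hVθ, hUA, hAA]
  have hX := gluedMode_spec ht hV0 hVU hUc hVc hUs hVs hU hV
  have hXA : ∀ k, gluedMode t U V d k (t k) = A k := fun k => by
    rw [gluedMode_of_mem_Icc ht hV0 hVU (left_mem_Icc.2 (ht k.lt_succ_self).le), hUA]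
  refine ⟨n₀, ∑' i, τ i, t, gluedMode t U V d, ht0, ht, hlt, htT, fun k => ?_,
    fun k j => (hX k j).2.1, fun k hk s _ hs => ?_, fun k s hs0 hsT hne => ?_, hXA,
    fun δ' hδ' M s₀ hs₀ => ?_⟩
  · simpa only [ht0] using
      continuousOn_Ico_of_forall_Icc_succ ht.monotone htT fun j => (hX k j).1
  · obtain ⟨k, rfl⟩ : ∃ i, k = i + 1 := ⟨k - 1, by omega⟩
    exact gluedMode_succ_of_le hs
  · obtain ⟨n, hn⟩ := (htT.eventually (lt_mem_nhds hsT)).exists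
    obtain ⟨j, hj⟩ := exists_mem_Ico_succ_of_lt (ht0.trans_le hs0) hn
    refine ((hX k j).2.2 s ⟨hj.1.lt_of_ne (hne j).symm, hj.2⟩).congr_deriv ?_
    congr 2
    split_ifs with h
    · simp only [g]
      rw [Nat.cast_sub h.1, Nat.cast_one, add_sub_assoc]
    · rfl
  · have hgrow : Filter.Tendsto (fun k : ℕ => (lam ^ (δ' - δ)) ^ k) Filter.atTop Filter.atTop :=
      tendsto_pow_atTop_atTop_of_one_lt (Real.one_lt_rpow hlam (sub_pos.2 hδ'))
    obtain ⟨k, hkM, hks⟩ := ((hgrow.eventually_gt_atTop M).and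
      (htT.eventually (lt_mem_nhds hs₀))).exists
    refine ⟨t k, hks.le, hlt k, k, hkM.trans_le ?_⟩
    rw [hXA, abs_of_pos (hA0 k), ← Real.rpow_add hlam0, ← Real.rpow_mul_natCast hlam0.le]
    refine Real.rpow_le_rpow_of_exponent_le hlam.le ?_
    nlinarith [mul_nonneg (hδ0.trans hδ').le (Nat.cast_nonneg (α := ℝ) n₀)]
end

section
/- Let λ > 1 and 0 < δ < 1. Then there exists ε* > 0 such that for all 0 ≤ ε, ε′ ≤ ε* the following holds: if x, y : [0, ∞) → ℝ are continuously differentiable with x(0) = 1, y(0) = 0, and satisfy ∂ₜx = −εx − xy and ∂ₜy = −ε′y + x² for all t ≥ 0, then there exists a time t with 0 < t ≤ 2·artanh(λ^{−δ}) such that y(t) = λ^{−δ}. -/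
/-- The inverse hyperbolic tangent. -/
noncomputable def arctanh (x : ℝ) : ℝ := Real.log ((1 + x) / (1 - x)) / 2

/-- A function on `[0, T]` whose derivative is nonnegative there does not fall below its
initial value. -/
theorem le_of_hasDerivWithinAt_nonneg_Ici {f f' : ℝ → ℝ} {T : ℝ}
    (hf : ∀ t, 0 ≤ t → t ≤ T → HasDerivWithinAt f (f' t) (Set.Ici 0) t)
    (hf' : ∀ t, 0 ≤ t → t ≤ T → 0 ≤ f' t) {t : ℝ} (ht0 : 0 ≤ t) (htT : t ≤ T) :
    f 0 ≤ f t := by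
  have hmono : MonotoneOn f (Set.Icc 0 T) := by
    refine monotoneOn_of_hasDerivWithinAt_nonneg (convex_Icc 0 T) (f' := f') ?_ ?_ ?_
    · exact fun s hs => (hf s hs.1 hs.2).continuousWithinAt.mono Set.Icc_subset_Ici_self
    · intro s hs
      have hs' := interior_subset hs
      exact (hf s hs'.1 hs'.2).mono (interior_subset.trans Set.Icc_subset_Ici_self)
    · intro s hs
      have hs' := interior_subset hs
      exact hf' s hs'.1 hs'.2
  exact hmono ⟨le_rfl, ht0.trans htT⟩ ⟨ht0, htT⟩ ht0

/-- If `y' ≥ -c y` and `y(0) ≥ 0` then `e^{ct} y(t) ≥ y(0)`. -/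
theorem le_exp_mul_of_neg_mul_le_deriv {y y' : ℝ → ℝ} {c : ℝ}
    (hy : ∀ t, 0 ≤ t → HasDerivWithinAt y (y' t) (Set.Ici 0) t)
    (hy' : ∀ t, 0 ≤ t → -c * y t ≤ y' t) {t : ℝ} (ht : 0 ≤ t) :
    y 0 ≤ Real.exp (c * t) * y t := by
  have h := le_of_hasDerivWithinAt_nonneg_Ici (T := t)
    (f := fun s => Real.exp (c * s) * y s)
    (f' := fun s => Real.exp (c * s) * (c * 1) * y s + Real.exp (c * s) * y' s)
    (fun s hs _ => (((hasDerivAt_id s).const_mul c).exp.hasDerivWithinAt).mul (hy s hs))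
    (fun s hs _ => by
      have := mul_nonneg (Real.exp_pos (c * s)).le
        (show 0 ≤ c * y s + y' s by linarith [hy' s hs])
      linarith) ht le_rfl
  simpa using h

/-- The squared amplitude of a pump gate decays at rate at most twice the dissipation. -/
theorem pump_energy_lower_bound {e ε ε' : ℝ} (he : 0 ≤ e) (hεe : ε ≤ e) (hεe' : ε' ≤ e)
    {x y : ℝ → ℝ} (hx0 : x 0 = 1) (hy0 : y 0 = 0)
    (hx : ∀ t : ℝ, 0 ≤ t → HasDerivWithinAt x (-ε * x t - x t * y t) (Set.Ici 0) t)
    (hy : ∀ t : ℝ, 0 ≤ t → HasDerivWithinAt y (-ε' * y t + x t ^ 2) (Set.Ici 0) t)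
    {t T : ℝ} (ht : 0 ≤ t) (htT : t ≤ T) :
    1 - 2 * e * T ≤ x t ^ 2 + y t ^ 2 := by
  have h := le_exp_mul_of_neg_mul_le_deriv (c := 2 * e) (y := fun s => x s ^ 2 + y s ^ 2)
    (fun s hs => ((hx s hs).pow 2).add ((hy s hs).pow 2))
    (fun s _ => by
      have h1 := mul_nonneg (sub_nonneg.2 hεe) (sq_nonneg (x s))
      have h2 := mul_nonneg (sub_nonneg.2 hεe') (sq_nonneg (y s))
      norm_num
      linarith) ht
  simp only [hx0, hy0] at h
  have hexp : Real.exp (-(2 * e * t)) ≤ x t ^ 2 + y t ^ 2 := by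
    rw [Real.exp_neg, inv_le_iff_one_le_mul₀' (Real.exp_pos _)]
    linarith
  have h1 := Real.add_one_le_exp (-(2 * e * t))
  have h2 := mul_le_mul_of_nonneg_left htT he
  linarith

/-- If `0 ≤ y < 1` and `y' ≥ (1 - y²) / 2` on `[0, T]`, with `y(0) = 0`, then
`T ≤ 2 artanh (y(T))`. -/
theorem le_two_mul_arctanh {y y' : ℝ → ℝ} {T : ℝ} (hT : 0 ≤ T) (hy0 : y 0 = 0)
    (hy : ∀ t, 0 ≤ t → HasDerivWithinAt y (y' t) (Set.Ici 0) t)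
    (hnonneg : ∀ t, 0 ≤ t → t ≤ T → 0 ≤ y t) (hlt : ∀ t, 0 ≤ t → t ≤ T → y t < 1)
    (hy' : ∀ t, 0 ≤ t → t ≤ T → (1 - y t ^ 2) / 2 ≤ y' t) :
    T ≤ 2 * arctanh (y T) := by
  have h := le_of_hasDerivWithinAt_nonneg_Ici (T := T)
    (f := fun s => Real.log (1 + y s) - Real.log (1 - y s) - s)
    (f' := fun s => y' s / (1 + y s) - -y' s / (1 - y s) - 1)
    (fun s hs hsT =>
      ((((hy s hs).const_add 1).log (by linarith [hnonneg s hs hsT])).sub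
        (((hy s hs).const_sub 1).log (by linarith [hlt s hs hsT]))).sub
        (hasDerivAt_id s).hasDerivWithinAt)
    (fun s hs hsT => by
      have h1 : 0 < 1 + y s := by linarith [hnonneg s hs hsT]
      have h2 : 0 < 1 - y s := by linarith [hlt s hs hsT]
      have h3 : y' s / (1 + y s) - -y' s / (1 - y s) - 1 =
          (2 * y' s - (1 - y s ^ 2)) / ((1 + y s) * (1 - y s)) := by
        field_simp
        ring
      rw [h3]
      exact div_nonneg (by linarith [hy' s hs hsT]) (mul_pos h1 h2).le) hT le_rfl
  have h1 : 1 + y T ≠ 0 := by linarith [hnonneg T hT le_rfl]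
  have h2 : 1 - y T ≠ 0 := by linarith [hlt T hT le_rfl]
  rw [arctanh, Real.log_div h1 h2]
  simp only [hy0, add_zero, sub_zero, Real.log_one] at h
  linarith

/-- Perturbed pump gate: for `λ > 1` and `0 < δ < 1` there is `ε* > 0` such that for all
dissipation parameters `0 ≤ ε, ε' ≤ ε*`, any continuously differentiable solution of
`∂ₜx = -εx - xy`, `∂ₜy = -ε'y + x²` with `x(0) = 1`, `y(0) = 0` reaches `y(t) = λ^{-δ}`
at some time `0 < t ≤ 2 artanh(λ^{-δ})`. -/
theorem perturbed_pump_reaches_level (lam δ : ℝ) (hlam : 1 < lam)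
    (hδ0 : 0 < δ) (hδ1 : δ < 1) :
    ∃ εstar : ℝ, 0 < εstar ∧
      ∀ ε ε' : ℝ, 0 ≤ ε → ε ≤ εstar → 0 ≤ ε' → ε' ≤ εstar →
        ∀ x y : ℝ → ℝ,
          x 0 = 1 → y 0 = 0 →
          (∀ t : ℝ, 0 ≤ t →
            HasDerivWithinAt x (-ε * x t - x t * y t) (Set.Ici 0) t) →
          (∀ t : ℝ, 0 ≤ t →
            HasDerivWithinAt y (-ε' * y t + x t ^ 2) (Set.Ici 0) t) →
          ∃ t : ℝ, 0 < t ∧ t ≤ 2 * arctanh (lam ^ (-δ)) ∧ y t = lam ^ (-δ) := by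
  have ha0 : 0 < lam ^ (-δ) := Real.rpow_pos_of_pos (by linarith) _
  have ha1 : lam ^ (-δ) < 1 := Real.rpow_lt_one_of_one_lt_of_neg hlam (by linarith)
  generalize lam ^ (-δ) = a at ha0 ha1 ⊢
  obtain ⟨T, hTdef⟩ : ∃ T, T = 2 * arctanh a := ⟨_, rfl⟩
  have hTlog : T = Real.log ((1 + a) / (1 - a)) := by rw [hTdef, arctanh]; ring
  have hT : 0 < T := by
    rw [hTlog]
    exact Real.log_pos ((one_lt_div (by linarith)).2 (by linarith))
  rw [← hTdef]
  have hgap : 0 < 1 - a ^ 2 := by nlinarith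
  refine ⟨(1 - a ^ 2) / (2 * (2 * T + 1)), by positivity, ?_⟩
  have hbudget : (1 - a ^ 2) / (2 * (2 * T + 1)) * (2 * T + 1) = (1 - a ^ 2) / 2 := by
    field_simp
  have hepos : 0 < (1 - a ^ 2) / (2 * (2 * T + 1)) := by positivity
  generalize (1 - a ^ 2) / (2 * (2 * T + 1)) = e at hbudget hepos ⊢
  intro ε ε' _ hεe _ hεe' x y hx0 hy0 hx hy
  have hnonneg : ∀ t, 0 ≤ t → 0 ≤ y t := fun t ht => by
    have h := le_exp_mul_of_neg_mul_le_deriv (c := ε') hy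
      (fun s _ => by linarith [sq_nonneg (x s)]) ht
    rw [hy0] at h
    exact nonneg_of_mul_nonneg_right h (Real.exp_pos _)
  by_cases hreach : ∃ t, 0 ≤ t ∧ t ≤ T ∧ a ≤ y t
  · obtain ⟨t, ht0, htT, hat⟩ := hreach
    have hcont : ContinuousOn y (Set.Icc 0 t) := fun s hs =>
      (hy s hs.1).continuousWithinAt.mono Set.Icc_subset_Ici_self
    obtain ⟨s, hs, hsa⟩ := intermediate_value_Icc ht0 hcont ⟨by rw [hy0]; exact ha0.le, hat⟩
    refine ⟨s, lt_of_le_of_ne hs.1 ?_, hs.2.trans htT, hsa⟩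
    rintro rfl
    linarith
  · push Not at hreach
    exfalso
    have h := le_two_mul_arctanh hT.le hy0 hy (fun t ht _ => hnonneg t ht)
      (fun t ht htT => (hreach t ht htT).trans ha1)
      (fun t ht htT => by
        have henergy := pump_energy_lower_bound hepos.le hεe hεe' hx0 hy0 hx hy ht htT
        have hya := hreach t ht htT
        have hyt := hnonneg t ht
        have hdamp : ε' * y t ≤ e :=
          (mul_le_mul_of_nonneg_right hεe' hyt).trans
            (mul_le_of_le_one_right hepos.le (hya.trans ha1).le)
        have hsq : y t ^ 2 ≤ a ^ 2 := pow_le_pow_left₀ hyt hya.le 2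
        linarith)
    have hyT := hreach T hT.le le_rfl
    have hyT0 := hnonneg T hT.le
    have hlt : Real.log ((1 + y T) / (1 - y T)) < Real.log ((1 + a) / (1 - a)) := by
      refine Real.log_lt_log (div_pos (by linarith) (by linarith)) ?_
      exact div_lt_div₀ (by linarith) (by linarith) (by linarith) (by linarith)
    rw [arctanh] at h
    linarith
end

section
/- Suppose K > 0, ε > 0, and (a, b, c, d, ã) : [0, ∞) → ℝ⁵ is a continuously differentiable solution of the system ∂ₜa = −ε⁻²cd − εab − ε²e^{−K¹⁰}ac, ∂ₜb = εa² − ε⁻¹K¹⁰c², ∂ₜc = ε²e^{−K¹⁰}a² + ε⁻¹K¹⁰bc, ∂ₜd = ε⁻²ca − Kdã, ∂ₜã = Kd², with a(0) = 1 and b(0) = c(0) = d(0) = ã(0) = 0. Then a(t)² + b(t)² + c(t)² + d(t)² + ã(t)² = 1 for all t ≥ 0, c(t) ≥ 0 for all t ≥ 0, and there is an absolute constant C₀ > 0 such that for all 0 ≤ t ≤ 2: |b(t)| ≤ C₀ε, |c(t)| ≤ C₀ε, c(t) ≤ C₀ε² exp((C₀t − 1)K¹⁰), and |d(t)|, |ã(t)|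 ≤ C₀K⁻¹⁰ exp((C₀t − 1)K¹⁰). -/
open Set in
/-- A function on `[0, ∞)` whose right derivative is nonpositive on `[0, T]` does not exceed its
initial value at `T`. -/
lemma le_initial_of_hasDerivWithinAt_nonpos {f f' : ℝ → ℝ} {T : ℝ} (hT : 0 ≤ T)
    (hf : ∀ t, 0 ≤ t → HasDerivWithinAt f (f' t) (Ici 0) t)
    (hf' : ∀ t, 0 ≤ t → t ≤ T → f' t ≤ 0) : f T ≤ f 0 := by
  have hanti : AntitoneOn f (Icc 0 T) := by
    refine antitoneOn_of_hasDerivWithinAt_nonpos (f' := f') (convex_Icc 0 T)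
      (fun t ht => ((hf t ht.1).continuousWithinAt).mono Icc_subset_Ici_self) ?_ ?_
    · intro t ht
      have ht' := interior_subset ht
      exact (hf t ht'.1).mono (interior_subset.trans Icc_subset_Ici_self)
    · intro t ht
      have ht' := interior_subset ht
      exact hf' t ht'.1 ht'.2
  exact hanti ⟨le_rfl, hT⟩ ⟨hT, le_rfl⟩ hT

open Set in
/-- If `q ≥ 0` vanishes at `0` and `q' ≤ 2 G' √q` on `[0, T]`, then `√q` grows at most like `G`. -/
lemma sqrt_le_sub_of_hasDerivWithinAt_le {q q' G g : ℝ → ℝ} {T : ℝ} (hT : 0 ≤ T)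
    (hq : ∀ t, 0 ≤ t → HasDerivWithinAt q (q' t) (Ici 0) t)
    (hG : ∀ t, 0 ≤ t → HasDerivWithinAt G (g t) (Ici 0) t)
    (hq_nonneg : ∀ t, 0 ≤ t → 0 ≤ q t) (hg : ∀ t, 0 ≤ t → 0 ≤ g t)
    (hle : ∀ t, 0 ≤ t → t ≤ T → q' t ≤ 2 * g t * √(q t)) (hq0 : q 0 = 0) :
    √(q T) ≤ G T - G 0 := by
  refine le_of_forall_pos_le_add fun η hη => ?_
  have hpos : ∀ t, 0 ≤ t → 0 < q t + η ^ 2 := fun t ht => by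
    have := hq_nonneg t ht
    positivity
  have key := le_initial_of_hasDerivWithinAt_nonpos
    (f := fun t => √(q t + η ^ 2) - G t)
    (f' := fun t => q' t / (2 * √(q t + η ^ 2)) - g t) hT
    (fun t ht => (((hq t ht).add_const (η ^ 2)).sqrt (hpos t ht).ne').sub (hG t ht))
    (fun t ht htT => by
      have hs : 0 < √(q t + η ^ 2) := Real.sqrt_pos.2 (hpos t ht)
      have hmono : √(q t) ≤ √(q t + η ^ 2) := Real.sqrt_le_sqrt (by nlinarith)
      have := mul_le_mul_of_nonneg_left hmono (hg t ht)
      rw [sub_nonpos, div_le_iff₀ (by positivity)]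
      linarith [hle t ht htT])
  have hmono : √(q T) ≤ √(q T + η ^ 2) := Real.sqrt_le_sqrt (by nlinarith)
  simp only [hq0, zero_add, Real.sqrt_sq hη.le] at key
  linarith

open Set in
/-- A solution of `c' = f + g c` on `[0, ∞)` with `c(0) = 0`, `f ≥ 0` and `g` continuous is
nonnegative. -/
lemma nonneg_of_hasDerivWithinAt_linear {c f g : ℝ → ℝ} (hg : ContinuousOn g (Ici 0))
    (hf : ∀ t, 0 ≤ t → 0 ≤ f t)
    (hc : ∀ t, 0 ≤ t → HasDerivWithinAt c (f t + g t * c t) (Ici 0) t) (hc0 : c 0 = 0)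
    {T : ℝ} (hT : 0 ≤ T) : 0 ≤ c T := by
  have hcont : Continuous fun t => g (max t 0) :=
    hg.comp_continuous (by fun_prop) fun t => le_max_right t 0
  have hI : ∀ t, 0 ≤ t → HasDerivAt (fun t => ∫ s in (0 : ℝ)..t, g (max s 0)) (g t) t := by
    intro t ht
    simpa [max_eq_left ht] using (hcont.integral_hasStrictDerivAt 0 t).hasDerivAt
  set I : ℝ → ℝ := fun t => ∫ s in (0 : ℝ)..t, g (max s 0)
  have key := le_initial_of_hasDerivWithinAt_nonpos
    (f := fun t => -(c t * Real.exp (-I t)))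
    (f' := fun t => -((f t + g t * c t) * Real.exp (-I t)
      + c t * (Real.exp (-I t) * -g t))) hT
    (fun t ht => ((hc t ht).mul (hI t ht).neg.exp.hasDerivWithinAt).neg)
    (fun t ht _ => by
      have := mul_nonneg (hf t ht) (Real.exp_pos (-I t)).le
      nlinarith)
  simp only [hc0, zero_mul, neg_zero, Left.neg_nonpos_iff] at key
  exact nonneg_of_mul_nonneg_left key (Real.exp_pos _)

/-- Crude bounds for the five-mode quadratic circuit: any solution with data `a(0)=1`,
`b(0)=c(0)=d(0)=ã(0)=0` conserves energy, keeps `c ≥ 0`, and satisfies (with an absolute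
constant `C₀`) the bounds `|b|, |c| ≤ C₀ ε`, `c ≤ C₀ ε² exp((C₀ t - 1)K¹⁰)` and
`|d|, |ã| ≤ C₀ K⁻¹⁰ exp((C₀ t - 1)K¹⁰)` on `[0,2]`. -/
theorem five_mode_crude_bounds :
    ∃ C₀ : ℝ, 0 < C₀ ∧
      ∀ K ε : ℝ, 0 < K → 0 < ε →
        ∀ a b c d ta : ℝ → ℝ,
          (∀ t : ℝ, 0 ≤ t → HasDerivWithinAt a
            (-(ε ^ 2)⁻¹ * c t * d t - ε * a t * b t -
              ε ^ 2 * Real.exp (-K ^ 10) * a t * c t) (Set.Ici 0) t) →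
          (∀ t : ℝ, 0 ≤ t → HasDerivWithinAt b
            (ε * a t ^ 2 - ε⁻¹ * K ^ 10 * c t ^ 2) (Set.Ici 0) t) →
          (∀ t : ℝ, 0 ≤ t → HasDerivWithinAt c
            (ε ^ 2 * Real.exp (-K ^ 10) * a t ^ 2 + ε⁻¹ * K ^ 10 * b t * c t)
              (Set.Ici 0) t) →
          (∀ t : ℝ, 0 ≤ t → HasDerivWithinAt d
            ((ε ^ 2)⁻¹ * c t * a t - K * d t * ta t) (Set.Ici 0) t) →
          (∀ t : ℝ, 0 ≤ t → HasDerivWithinAt ta (K * d t ^ 2) (Set.Ici 0) t) →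
          a 0 = 1 → b 0 = 0 → c 0 = 0 → d 0 = 0 → ta 0 = 0 →
          (∀ t : ℝ, 0 ≤ t →
            a t ^ 2 + b t ^ 2 + c t ^ 2 + d t ^ 2 + ta t ^ 2 = 1) ∧
          (∀ t : ℝ, 0 ≤ t → 0 ≤ c t) ∧
          (∀ t : ℝ, 0 ≤ t → t ≤ 2 →
            |b t| ≤ C₀ * ε ∧ |c t| ≤ C₀ * ε ∧
            c t ≤ C₀ * ε ^ 2 * Real.exp ((C₀ * t - 1) * K ^ 10) ∧
            |d t| ≤ C₀ * (K ^ 10)⁻¹ * Real.exp ((C₀ * t - 1) * K ^ 10) ∧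
            |ta t| ≤ C₀ * (K ^ 10)⁻¹ * Real.exp ((C₀ * t - 1) * K ^ 10)) := by
  refine ⟨4, by norm_num, ?_⟩
  intro K ε hK hε a b c d ta ha hb hc hd hta ha0 hb0 hc0 hd0 hta0
  have energy : ∀ t : ℝ, 0 ≤ t →
      a t ^ 2 + b t ^ 2 + c t ^ 2 + d t ^ 2 + ta t ^ 2 = 1 := by
    intro T hT
    have hE : ∀ t, 0 ≤ t → HasDerivWithinAt
        (fun t => a t ^ 2 + b t ^ 2 + c t ^ 2 + d t ^ 2 + ta t ^ 2) 0 (Set.Ici 0) t := by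
      intro t ht
      have h := (((((ha t ht).pow 2).add ((hb t ht).pow 2)).add ((hc t ht).pow 2)).add
        ((hd t ht).pow 2)).add ((hta t ht).pow 2)
      refine h.congr_deriv ?_
      norm_num
      ring
    have h1 := le_initial_of_hasDerivWithinAt_nonpos hT hE (fun _ _ _ => le_rfl)
    have h2 := le_initial_of_hasDerivWithinAt_nonpos hT (fun t ht => (hE t ht).neg)
      (fun _ _ _ => neg_zero.le)
    simp only [Pi.neg_apply, ha0, hb0, hc0, hd0, hta0] at h1 h2
    linarith
  have hL : 0 < K ^ 10 := by positivity
  generalize K ^ 10 = L at *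
  have hc_nonneg : ∀ t : ℝ, 0 ≤ t → 0 ≤ c t := by
    intro T hT
    refine nonneg_of_hasDerivWithinAt_linear (g := fun t => ε⁻¹ * L * b t)
      (f := fun t => ε ^ 2 * Real.exp (-L) * a t ^ 2) ?_ (fun t _ => by positivity) hc hc0 hT
    exact continuousOn_const.mul fun t ht => (hb t ht).continuousWithinAt
  have ha_sq : ∀ t, 0 ≤ t → a t ^ 2 ≤ 1 := fun t ht => by
    nlinarith [energy t ht, sq_nonneg (b t), sq_nonneg (c t), sq_nonneg (d t), sq_nonneg (ta t)]
  refine ⟨energy, hc_nonneg, fun T hT hT2 => ?_⟩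
  have hbc : √(b T ^ 2 + c T ^ 2) ≤ 4 * ε := by
    rcases le_total 1 ε with h1 | h1
    · have : √(b T ^ 2 + c T ^ 2) ≤ 1 := by
        rw [Real.sqrt_le_one]
        nlinarith [energy T hT, sq_nonneg (a T), sq_nonneg (d T), sq_nonneg (ta T)]
      linarith
    · have h := sqrt_le_sub_of_hasDerivWithinAt_le (G := fun t => 2 * ε * t)
        (g := fun _ => 2 * ε * 1) hT
        (fun t ht => ((hb t ht).pow 2).add ((hc t ht).pow 2))
        (fun t _ => ((hasDerivAt_id t).const_mul (2 * ε)).hasDerivWithinAt)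
        (fun t _ => by simp only [Pi.add_apply, Pi.pow_apply]; positivity)
        (fun t _ => by positivity)
        (fun t ht _ => by
          simp only [Pi.add_apply, Pi.pow_apply]
          have hbs : b t ≤ √(b t ^ 2 + c t ^ 2) :=
            (le_abs_self _).trans (Real.abs_le_sqrt (by nlinarith [sq_nonneg (c t)]))
          have hcs : c t ≤ √(b t ^ 2 + c t ^ 2) :=
            (le_abs_self _).trans (Real.abs_le_sqrt (by nlinarith [sq_nonneg (b t)]))
          have hs0 := Real.sqrt_nonneg (b t ^ 2 + c t ^ 2)
          set s := √(b t ^ 2 + c t ^ 2)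
          have hεe : ε * Real.exp (-L) ≤ 1 :=
            mul_le_one₀ h1 (Real.exp_pos _).le (Real.exp_le_one_iff.2 (by linarith))
          have hec : ε * Real.exp (-L) * c t ≤ s := by
            nlinarith [mul_le_of_le_one_left (hc_nonneg t ht) hεe]
          have hsum : a t ^ 2 * (b t + ε * Real.exp (-L) * c t) ≤ 2 * s :=
            calc a t ^ 2 * (b t + ε * Real.exp (-L) * c t)
                ≤ a t ^ 2 * (2 * s) :=
                  mul_le_mul_of_nonneg_left (by linarith) (sq_nonneg _)
              _ ≤ 2 * s := mul_le_of_le_one_left (by linarith) (ha_sq t ht)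
          have := mul_le_mul_of_nonneg_left hsum hε.le
          norm_num
          linarith)
        (by simp [hb0, hc0])
      simp only [Pi.add_apply, Pi.pow_apply] at h
      nlinarith
  have hb_le : ∀ t, 0 ≤ t → b t ≤ ε * t := by
    intro t ht
    have h := le_initial_of_hasDerivWithinAt_nonpos ht
      (fun s hs => (hb s hs).sub ((hasDerivAt_id s).const_mul ε).hasDerivWithinAt)
      (fun s hs _ => by
        have h1 := mul_le_mul_of_nonneg_left (ha_sq s hs) hε.le
        have h2 : 0 ≤ ε⁻¹ * L * c s ^ 2 := by positivity
        linarith)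
    simp only [Pi.sub_apply, id, hb0] at h
    linarith
  have hc_le : ∀ t, 0 ≤ t → t ≤ 2 → c t ≤ 2 * ε ^ 2 * Real.exp ((2 * t - 1) * L) := by
    intro t ht ht2
    have h := le_initial_of_hasDerivWithinAt_nonpos ht
      (fun s hs => ((hc s hs).mul
        ((hasDerivAt_id s).const_mul (-(2 * L))).exp.hasDerivWithinAt).sub
        ((hasDerivAt_id s).const_mul (ε ^ 2 * Real.exp (-L))).hasDerivWithinAt)
      (fun s hs hst => by
        simp only [id]
        have hcs := hc_nonneg s hs
        have hb2 : ε⁻¹ * b s ≤ 2 := by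
          rw [inv_mul_le_iff₀ hε]
          nlinarith [hb_le s hs]
        have h1 : ε⁻¹ * L * b s * c s ≤ 2 * L * c s := by
          nlinarith [mul_le_mul_of_nonneg_right hb2 (mul_nonneg hL.le hcs)]
        have hP : 0 ≤ ε ^ 2 * Real.exp (-L) := by positivity
        have h2 := mul_le_mul_of_nonneg_left (ha_sq s hs) hP
        have he0 := Real.exp_pos (-(2 * L) * s)
        have he1 : Real.exp (-(2 * L) * s) ≤ 1 := Real.exp_le_one_iff.2 (by nlinarith)
        have h3 : (ε ^ 2 * Real.exp (-L) * a s ^ 2 + ε⁻¹ * L * b s * c s - 2 * L * c s)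
            * Real.exp (-(2 * L) * s) ≤ ε ^ 2 * Real.exp (-L) * Real.exp (-(2 * L) * s) :=
          mul_le_mul_of_nonneg_right (by linarith) he0.le
        have h4 := mul_le_mul_of_nonneg_left he1 hP
        linarith)
    simp only [Pi.sub_apply, Pi.mul_apply, id, hc0] at h
    have hP : 0 < ε ^ 2 * Real.exp (-L) := by positivity
    have h5 : c t * Real.exp (-(2 * L) * t) ≤ 2 * (ε ^ 2 * Real.exp (-L)) := by nlinarith
    have h6 := mul_le_mul_of_nonneg_right h5 (Real.exp_pos (2 * L * t)).le
    have h7 : Real.exp (-(2 * L) * t) * Real.exp (2 * L * t) = 1 := by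
      rw [← Real.exp_add]; simp
    have h8 : Real.exp (-L) * Real.exp (2 * L * t) = Real.exp ((2 * t - 1) * L) := by
      rw [← Real.exp_add]; congr 1; ring
    calc c t = c t * Real.exp (-(2 * L) * t) * Real.exp (2 * L * t) := by
          rw [mul_assoc, h7, mul_one]
      _ ≤ _ := h6
      _ = _ := by rw [← h8]; ring
  have hd_le : √(d T ^ 2 + ta T ^ 2) ≤ L⁻¹ * Real.exp ((2 * T - 1) * L) := by
    have h := sqrt_le_sub_of_hasDerivWithinAt_le
      (G := fun t => L⁻¹ * Real.exp ((2 * t - 1) * L))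
      (g := fun t => 2 * Real.exp ((2 * t - 1) * L)) hT
      (fun t ht => ((hd t ht).pow 2).add ((hta t ht).pow 2))
      (fun t _ => by
        have h := (((((hasDerivAt_id t).const_mul 2).sub_const 1).mul_const L).exp.const_mul
          L⁻¹).hasDerivWithinAt (s := Set.Ici 0)
        refine h.congr_deriv ?_
        simp only [id]
        field_simp)
      (fun t _ => by simp only [Pi.add_apply, Pi.pow_apply]; positivity)
      (fun t _ => by positivity)
      (fun t ht htT => by
        simp only [Pi.add_apply, Pi.pow_apply]
        have hds : |d t| ≤ √(d t ^ 2 + ta t ^ 2) :=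
          Real.abs_le_sqrt (by nlinarith [sq_nonneg (ta t)])
        set s := √(d t ^ 2 + ta t ^ 2)
        have ha1 : |a t| ≤ 1 := abs_le_one_iff_mul_self_le_one.2 (by nlinarith [ha_sq t ht])
        have hcε : (ε ^ 2)⁻¹ * c t ≤ 2 * Real.exp ((2 * t - 1) * L) := by
          rw [inv_mul_le_iff₀ (by positivity)]
          linarith [hc_le t ht (htT.trans hT2)]
        have hcs := hc_nonneg t ht
        have had : a t * d t ≤ s := by
          calc a t * d t ≤ |a t * d t| := le_abs_self _
            _ = |a t| * |d t| := abs_mul _ _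
            _ ≤ |d t| := mul_le_of_le_one_left (abs_nonneg _) ha1
            _ ≤ s := hds
        have h1 : (ε ^ 2)⁻¹ * c t * (a t * d t) ≤ (ε ^ 2)⁻¹ * c t * s :=
          mul_le_mul_of_nonneg_left had (by positivity)
        have h2 := mul_le_mul_of_nonneg_right hcε (Real.sqrt_nonneg (d t ^ 2 + ta t ^ 2))
        norm_num
        linarith)
      (by simp [hd0, hta0])
    simp only [Pi.add_apply, Pi.pow_apply] at h
    have : 0 < L⁻¹ * Real.exp ((2 * 0 - 1) * L) := by positivity
    linarith
  have hexp : Real.exp ((2 * T - 1) * L) ≤ Real.exp ((4 * T - 1) * L) :=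
    Real.exp_le_exp.2 (by nlinarith)
  have hd_le' : √(d T ^ 2 + ta T ^ 2) ≤ 4 * L⁻¹ * Real.exp ((4 * T - 1) * L) := by
    have h1 := mul_le_mul_of_nonneg_left hexp (inv_pos.2 hL).le
    have h2 : 0 < L⁻¹ * Real.exp ((4 * T - 1) * L) := by positivity
    linarith
  refine ⟨(Real.abs_le_sqrt (by nlinarith [sq_nonneg (c T)])).trans hbc,
    (Real.abs_le_sqrt (by nlinarith [sq_nonneg (b T)])).trans hbc, ?_,
    (Real.abs_le_sqrt (by nlinarith [sq_nonneg (ta T)])).trans hd_le',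
    (Real.abs_le_sqrt (by nlinarith [sq_nonneg (d T)])).trans hd_le'⟩
  calc c T ≤ 2 * ε ^ 2 * Real.exp ((2 * T - 1) * L) := hc_le T hT hT2
    _ ≤ 4 * ε ^ 2 * Real.exp ((4 * T - 1) * L) := by gcongr; norm_num
end

section
/- Under the rescaled-system hypotheses (i)–(ix), at time 0 one has: Ẽ_{1−m}(0) ≤ (1+ε₀)^{−0.08}K⁻¹⁰(1+ε₀)^{m/10} for all m ≥ 2; Ẽ₀(0) + Ẽ₁(0) ≤ 0.6; Ẽ_{1+m}(0) ≤ (1+ε₀)^{−9.98}K⁻³⁰(1+ε₀)^{−10m} for all m ≥ 1; and |d₁(0)| ≤ √2·K⁻¹⁵. -/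
/-- A sequence that increases on consecutive integers of `[p, 0]` is minimal at `p`. -/
theorem le_of_lt_succ_of_nonpos {τ : ℤ → ℝ} {p : ℤ}
    (hmono : ∀ k : ℤ, p ≤ k → k < 0 → τ k < τ (k + 1)) {k : ℤ} (hpk : p ≤ k) (hk : k ≤ 0) :
    τ p ≤ τ k := by
  induction k, hpk using Int.leInduction with
  | base => exact le_rfl
  | succ k hpk ih => exact (ih (by lia)).trans (hmono k hpk (by lia)).le

/-- If the integral of `f` over `[τ (-j - 1), τ (-j)]` is at most `B * q ^ j`, then the integral
of `f` over `[τ p, τ 0]` is bounded by the sum of the geometric series. -/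
theorem integral_le_of_geometric {τ : ℤ → ℝ} {f : ℝ → ℝ} {p : ℤ} {B q : ℝ} (hp : p ≤ 0)
    (hmono : ∀ k : ℤ, p ≤ k → k < 0 → τ k < τ (k + 1)) (hB : 0 ≤ B) (hq : 0 ≤ q) (hq1 : q < 1)
    (hf : ContinuousOn f (Set.Ici (τ p)))
    (hstep : ∀ j : ℕ, p < -(j : ℤ) →
      ∫ s in (τ (-(j : ℤ) - 1))..(τ (-(j : ℤ))), f s ≤ B * q ^ j) :
    ∫ s in (τ p)..(τ 0), f s ≤ B / (1 - q) := by
  have hq' : 0 < 1 - q := by linarith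
  have hint : ∀ k l : ℤ, p ≤ k → k ≤ 0 → p ≤ l → l ≤ 0 →
      IntervalIntegrable f MeasureTheory.volume (τ k) (τ l) := fun k l hk hk' hl hl' =>
    (hf.mono fun s hs => (le_min (le_of_lt_succ_of_nonpos hmono hk hk')
      (le_of_lt_succ_of_nonpos hmono hl hl')).trans hs.1).intervalIntegrable
  have key : ∀ j : ℕ, p ≤ -(j : ℤ) →
      ∫ s in (τ (-(j : ℤ)))..(τ 0), f s ≤ B / (1 - q) * (1 - q ^ j) := by
    intro j
    induction j with
    | zero => intro _; simp
    | succ j ih =>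
      intro hj
      push_cast at hj ⊢
      rw [neg_add, ← sub_eq_add_neg] at hj ⊢
      rw [← intervalIntegral.integral_add_adjacent_intervals
        (hint _ (-(j : ℤ)) hj (by lia) (by lia) (by lia))
        (hint (-(j : ℤ)) 0 (by lia) (by lia) (by lia) le_rfl)]
      calc _ ≤ B * q ^ j + B / (1 - q) * (1 - q ^ j) :=
            add_le_add (hstep j (by lia)) (ih (by lia))
        _ = B / (1 - q) * (1 - q ^ (j + 1)) := by field_simp; ring
  obtain ⟨j, hj⟩ := Int.exists_eq_neg_ofNat hp
  have h := key j hj.le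
  rw [← hj] at h
  refine h.trans (mul_le_of_le_one_right (by positivity) ?_)
  linarith [pow_nonneg hq j]

/-- The energy at scale `0`, integrated over all past time, is bounded independently of the
number `-p` of scales. -/
theorem integral_energy_le {x C Q : ℝ} {τ : ℤ → ℝ} {p : ℤ} {E : ℤ → ℝ → ℝ} (hx : 1 < x)
    (hC : 0 < C) (hQ : Q ≤ 1) (hp : p ≤ 0)
    (hmono : ∀ k : ℤ, p ≤ k → k < 0 → τ k < τ (k + 1))
    (hE0 : ∀ (k : ℤ) (t : ℝ), τ p ≤ t → 0 ≤ E k t)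
    (hcont : ContinuousOn (E 0) (Set.Ici (τ p)))
    (hτ : ∀ k : ℤ, p ≤ k → k ≤ 0 →
      -C * x ^ ((5 / 2 + 1 / 100) * |(k : ℝ)|) ≤ τ k ∧ τ k ≤ 0)
    (hE : ∀ k : ℤ, p < k → k ≤ 0 → ∀ t : ℝ, τ (k - 1) ≤ t → t ≤ τ k →
      E (k - 1) t + E k t ≤ x ^ (|(k : ℝ) - 1| / 50) ∧
      ∀ m : ℕ, 1 ≤ m → E (k + (m : ℤ)) t ≤ Q * x ^ (-10 * (m : ℝ) + |(k : ℝ) - 1| / 50)) :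
    ∫ s in (τ p)..(τ 0), E 0 s ≤ C * x ^ (2.53 : ℝ) / (1 - x ^ (-7.47 : ℝ)) := by
  have hx0 : 0 < x := by linarith
  refine integral_le_of_geometric hp hmono (by positivity) (by positivity)
    (Real.rpow_lt_one_of_one_lt_of_neg hx (by norm_num)) hcont fun j hj => ?_
  have hle : τ (-(j : ℤ) - 1) ≤ τ (-(j : ℤ)) := by
    have h := hmono (-(j : ℤ) - 1) (by lia) (by lia)
    rw [sub_add_cancel] at h
    exact h.le
  have hpj : τ p ≤ τ (-(j : ℤ) - 1) := le_of_lt_succ_of_nonpos hmono (by lia) (by lia)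
  have habs : |((-(j : ℤ) : ℤ) : ℝ) - 1| = j + 1 := by
    push_cast
    rw [abs_of_nonpos (by linarith [Nat.cast_nonneg (α := ℝ) j])]
    ring
  have hsup : ∀ s ∈ Set.Icc (τ (-(j : ℤ) - 1)) (τ (-(j : ℤ))),
      E 0 s ≤ x ^ (-9.98 * (j : ℝ) + 0.02) := by
    intro s hs
    obtain ⟨h1, h2⟩ := hE (-(j : ℤ)) hj (by lia) s hs.1 hs.2
    rw [habs] at h1 h2
    rcases Nat.eq_zero_or_pos j with rfl | hj0
    · have h3 := hE0 (-((0 : ℕ) : ℤ) - 1) s (hpj.trans hs.1)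
      have h4 : E 0 s ≤ x ^ ((((0 : ℕ) : ℝ) + 1) / 50) := by
        simp only [Nat.cast_zero, neg_zero] at h1 h3 ⊢
        exact (le_add_of_nonneg_left h3).trans h1
      refine h4.trans_eq ?_
      congr 1
      norm_num
    · have h3 := h2 j hj0
      rw [neg_add_cancel] at h3
      refine h3.trans ((mul_le_of_le_one_left (by positivity) hQ).trans_eq ?_)
      congr 1
      ring
  have hlen : τ (-(j : ℤ)) - τ (-(j : ℤ) - 1) ≤ C * x ^ (2.51 * ((j : ℝ) + 1)) := by
    have h1 := (hτ (-(j : ℤ) - 1) (by lia) (by lia)).1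
    have h2 := (hτ (-(j : ℤ)) (by lia) (by lia)).2
    have h3 : (5 / 2 + 1 / 100) * |((-(j : ℤ) - 1 : ℤ) : ℝ)| = 2.51 * ((j : ℝ) + 1) := by
      rw [Int.cast_sub, Int.cast_one, habs]
      ring
    rw [h3] at h1
    linarith
  calc ∫ s in (τ (-(j : ℤ) - 1))..(τ (-(j : ℤ))), E 0 s
      ≤ ∫ _ in (τ (-(j : ℤ) - 1))..(τ (-(j : ℤ))), x ^ (-9.98 * (j : ℝ) + 0.02) := by
        refine intervalIntegral.integral_mono_on hle ?_ (by simp) hsup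
        refine (hcont.mono fun s hs => ?_).intervalIntegrable
        rw [Set.uIcc_of_le hle] at hs
        exact hpj.trans hs.1
    _ = (τ (-(j : ℤ)) - τ (-(j : ℤ) - 1)) * x ^ (-9.98 * (j : ℝ) + 0.02) := by simp
    _ ≤ C * x ^ (2.51 * ((j : ℝ) + 1)) * x ^ (-9.98 * (j : ℝ) + 0.02) := by gcongr
    _ = C * x ^ (2.53 : ℝ) * (x ^ (-7.47 : ℝ)) ^ j := by
        rw [← Real.rpow_mul_natCast hx0.le, mul_assoc, mul_assoc, ← Real.rpow_add hx0,
          ← Real.rpow_add hx0]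
        congr 2
        ring

/-- For large `n`, the factor `C * x ^ (-n / 2)` beats any fixed constant `A`. -/
theorem exists_forall_mul_rpow_neg_half_mul_le {x C A : ℝ} (hx : 1 < x) (hC : 0 < C)
    (hA : 0 < A) :
    ∃ n₁ : ℤ, ∀ n : ℤ, n₁ ≤ n → C * x ^ (-(n : ℝ) / 2) * A ≤ 0.01 := by
  have hx0 : 0 < x := by linarith
  obtain ⟨M, hM⟩ := exists_pow_lt_of_lt_one (show 0 < 0.01 / (C * A) by positivity)
    (Real.rpow_lt_one_of_one_lt_of_neg hx (show (-1 / 2 : ℝ) < 0 by norm_num))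
  refine ⟨M, fun n hn => ?_⟩
  have hn' : (M : ℝ) ≤ n := by exact_mod_cast hn
  rw [← Real.rpow_mul_natCast hx0.le, lt_div_iff₀ (by positivity)] at hM
  have h : x ^ (-(n : ℝ) / 2) ≤ x ^ (-1 / 2 * (M : ℝ)) :=
    Real.rpow_le_rpow_of_exponent_le hx.le (by linarith)
  calc C * x ^ (-(n : ℝ) / 2) * A = x ^ (-(n : ℝ) / 2) * (C * A) := by ring
    _ ≤ x ^ (-1 / 2 * (M : ℝ)) * (C * A) := by gcongr
    _ ≤ 0.01 := hM.le

/-- The contribution of `a₀, b₀, c₀, d₀` to the energy at time `0` is close to `1 / 2`. -/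
theorem half_sum_sq_le {a b c d ε K : ℝ} (hK : 10 ≤ K) (hε : 0 < ε) (hε1 : ε ≤ 1) (ha : a = 1)
    (hb : |b| ≤ ε / 10 ^ 5) (hc : |c| ≤ Real.exp (-K ^ 10) * ε ^ 2 / 10 ^ 5)
    (hd : |d| ≤ (K ^ 10)⁻¹) : (a ^ 2 + b ^ 2 + c ^ 2 + d ^ 2) / 2 ≤ 0.53 := by
  have hb' : |b| ≤ 0.1 := hb.trans (by norm_num; linarith)
  have he : Real.exp (-K ^ 10) ≤ 1 := Real.exp_le_one_iff.2 (by simp; positivity)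
  have hc' : |c| ≤ 0.1 := by
    have : Real.exp (-K ^ 10) * ε ^ 2 ≤ 1 * 1 ^ 2 := by gcongr
    exact hc.trans (by norm_num at this ⊢; linarith)
  have hd' : |d| ≤ 0.1 := by
    refine hd.trans ?_
    rw [show (0.1 : ℝ) = (10 : ℝ)⁻¹ by norm_num]
    gcongr
    exact hK.trans (le_self_pow₀ (by linarith) (by norm_num))
  have hb2 := sq_le_sq' (abs_le.1 hb').1 (abs_le.1 hb').2
  have hc2 := sq_le_sq' (abs_le.1 hc').1 (abs_le.1 hc').2
  have hd2 := sq_le_sq' (abs_le.1 hd').1 (abs_le.1 hd').2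
  rw [ha]
  norm_num at *
  linarith

/-- Initial bounds for the rescaled system: at time `0`, the energies away from scales
`0, 1` obey improved bounds, `Ẽ₀(0) + Ẽ₁(0) ≤ 0.6`, and `|d₁(0)| ≤ √2 K⁻¹⁵`. -/
theorem rescaled_initial_bounds (ε₀ : ℝ) (hε₀ : 0 < ε₀) (hε₀' : ε₀ < 1) :
    ∃ K₀ : ℝ, ∀ K : ℝ, K₀ ≤ K →
      ∃ ε₁ : ℝ, 0 < ε₁ ∧ ∀ ε : ℝ, 0 < ε → ε ≤ ε₁ →
        ∀ C : ℝ, 0 < C →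
          ∃ n₁ : ℤ, ∀ n₀ : ℤ, n₁ ≤ n₀ →
            ∀ (N : ℤ) (τ : ℤ → ℝ) (a b c d a' b' c' d' E E' : ℤ → ℝ → ℝ),
            n₀ ≤ N →
            (∀ k : ℤ, n₀ - N ≤ k → k < 0 → τ k < τ (k + 1)) →
            τ 0 = 0 →
            (∀ (k : ℤ) (t : ℝ), τ (n₀ - N) ≤ t → 0 ≤ E k t) →
            (∀ (k : ℤ) (t : ℝ), τ (n₀ - N) ≤ t →
              HasDerivWithinAt (a k) (a' k t) (Set.Ici (τ (n₀ - N))) t ∧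
              HasDerivWithinAt (b k) (b' k t) (Set.Ici (τ (n₀ - N))) t ∧
              HasDerivWithinAt (c k) (c' k t) (Set.Ici (τ (n₀ - N))) t ∧
              HasDerivWithinAt (d k) (d' k t) (Set.Ici (τ (n₀ - N))) t ∧
              HasDerivWithinAt (E k) (E' k t) (Set.Ici (τ (n₀ - N))) t) →
            (∀ k : ℤ,
              ContinuousOn (a' k) (Set.Ici (τ (n₀ - N))) ∧
              ContinuousOn (b' k) (Set.Ici (τ (n₀ - N))) ∧
              ContinuousOn (c' k) (Set.Ici (τ (n₀ - N))) ∧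
              ContinuousOn (d' k) (Set.Ici (τ (n₀ - N))) ∧
              ContinuousOn (E' k) (Set.Ici (τ (n₀ - N)))) →
            (∀ T : ℝ, ∃ M : ℝ, ∀ (k : ℤ) (t : ℝ), τ (n₀ - N) ≤ t → t ≤ T →
              (1 + (1 + ε₀) ^ (10 * (k : ℝ))) * (|a k t| + |b k t| + |c k t| + |d k t|) ≤ M ∧
              (1 + (1 + ε₀) ^ (10 * (k : ℝ))) * Real.sqrt (E k t) ≤ M) →
            (∀ (k : ℤ) (t : ℝ), τ (n₀ - N) ≤ t →
              |a' k t - (1 + ε₀) ^ (5 * (k : ℝ) / 2) *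
                  (-(ε ^ 2)⁻¹ * c k t * d k t - ε * a k t * b k t -
                    ε ^ 2 * Real.exp (-K ^ 10) * a k t * c k t + K * d (k - 1) t ^ 2)| ≤
                C * (1 + ε₀) ^ (2 * (k : ℝ) - (n₀ : ℝ) / 2) * Real.sqrt (E k t) ∧
              |b' k t - (1 + ε₀) ^ (5 * (k : ℝ) / 2) *
                  (ε * a k t ^ 2 - ε⁻¹ * K ^ 10 * c k t ^ 2)| ≤
                C * (1 + ε₀) ^ (2 * (k : ℝ) - (n₀ : ℝ) / 2) * Real.sqrt (E k t) ∧
              |c' k t - (1 + ε₀) ^ (5 * (k : ℝ) / 2) *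
                  (ε ^ 2 * Real.exp (-K ^ 10) * a k t ^ 2 + ε⁻¹ * K ^ 10 * b k t * c k t)| ≤
                C * (1 + ε₀) ^ (2 * (k : ℝ) - (n₀ : ℝ) / 2) * Real.sqrt (E k t) ∧
              |d' k t - (1 + ε₀) ^ (5 * (k : ℝ) / 2) *
                  ((ε ^ 2)⁻¹ * c k t * a k t -
                    (1 + ε₀) ^ ((5 : ℝ) / 2) * K * d k t * a (k + 1) t)| ≤
                C * (1 + ε₀) ^ (2 * (k : ℝ) - (n₀ : ℝ) / 2) * Real.sqrt (E k t) ∧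
              E' k t ≤ K * (1 + ε₀) ^ (5 * (k : ℝ) / 2) *
                (d (k - 1) t ^ 2 * a k t - (1 + ε₀) ^ ((5 : ℝ) / 2) * d k t ^ 2 * a (k + 1) t)) →
            (∀ k : ℤ, n₀ - N < k →
              a k (τ (n₀ - N)) = 0 ∧ b k (τ (n₀ - N)) = 0 ∧ c k (τ (n₀ - N)) = 0 ∧
                d k (τ (n₀ - N)) = 0 ∧ E k (τ (n₀ - N)) = 0) →
            (∀ (k : ℤ) (t : ℝ), τ (n₀ - N) ≤ t →
              (a k t ^ 2 + b k t ^ 2 + c k t ^ 2 + d k t ^ 2) / 2 ≤ E k t ∧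
              E k t ≤ (a k t ^ 2 + b k t ^ 2 + c k t ^ 2 + d k t ^ 2) / 2 +
                C * (1 + ε₀) ^ (2 * (k : ℝ) - (n₀ : ℝ) / 2) * ∫ s in (τ (n₀ - N))..t, E k s) →
            (∀ k : ℤ, k < n₀ - N → ∀ t : ℝ, τ (n₀ - N) ≤ t →
              a k t = 0 ∧ b k t = 0 ∧ c k t = 0 ∧ d k t = 0 ∧ E k t = 0) →
            (∀ k : ℤ, n₀ - N ≤ k → k ≤ 0 →
              -C * (1 + ε₀) ^ ((5 / 2 + 1 / 100) * |(k : ℝ)|) ≤ τ k ∧ τ k ≤ 0) →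
            a 0 0 = 1 →
            |b 0 0| ≤ ε / 10 ^ 5 →
            |c 0 0| ≤ Real.exp (-K ^ 10) * ε ^ 2 / 10 ^ 5 →
            -(1 + ε₀) ^ (-(n₀ : ℝ) / 4) ≤ c 0 0 →
            |d 0 0| ≤ (K ^ 10)⁻¹ →
            E (-1) 0 ≤ (K ^ 20)⁻¹ →
            (n₀ < N →
              ε / 10 ^ 5 ≤ b (-1) 0 ∧ b (-1) 0 ≤ 10 ^ 5 * ε ∧
              Real.exp (K ^ 9) * ε ^ 2 ≤ c (-1) 0 ∧ c (-1) 0 ≤ Real.exp (K ^ 10) * ε ^ 2) →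
            (∀ k : ℤ, n₀ - N < k → k ≤ 0 → ∀ t : ℝ, τ (k - 1) ≤ t → t ≤ τ k →
              (∀ m : ℕ, 2 ≤ m →
                E (k - (m : ℤ)) t ≤ (K ^ 10)⁻¹ * (1 + ε₀) ^ ((m : ℝ) / 10 + |(k : ℝ) - 1| / 50)) ∧
              E (k - 1) t + E k t ≤ (1 + ε₀) ^ (|(k : ℝ) - 1| / 50) ∧
              (∀ m : ℕ, 1 ≤ m →
                E (k + (m : ℤ)) t ≤ (K ^ 30)⁻¹ * (1 + ε₀) ^ (-10 * (m : ℝ) + |(k : ℝ) - 1| / 50))) →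
            (∀ m : ℕ, 2 ≤ m →
              E (1 - (m : ℤ)) 0 ≤
                (1 + ε₀) ^ (-(0.08 : ℝ)) * ((K ^ 10)⁻¹ * (1 + ε₀) ^ ((m : ℝ) / 10))) ∧
            E 0 0 + E 1 0 ≤ 0.6 ∧
            (∀ m : ℕ, 1 ≤ m →
              E (1 + (m : ℤ)) 0 ≤
                (1 + ε₀) ^ (-(9.98 : ℝ)) * ((K ^ 30)⁻¹ * (1 + ε₀) ^ (-10 * (m : ℝ)))) ∧
            |d 1 0| ≤ Real.sqrt 2 * (K ^ 15)⁻¹ := by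
  refine ⟨10, fun K hK => ⟨1, one_pos, fun ε hε hε1 C hC => ?_⟩⟩
  have hx : 1 < 1 + ε₀ := by linarith
  have hx0 : 0 < 1 + ε₀ := by linarith
  have hK0 : 0 < K := by linarith
  have hK1 : 1 ≤ K := by linarith
  have hq1 : 0 < 1 - (1 + ε₀) ^ (-7.47 : ℝ) :=
    sub_pos.2 (Real.rpow_lt_one_of_one_lt_of_neg hx (by norm_num))
  obtain ⟨n₁, hn₁⟩ := exists_forall_mul_rpow_neg_half_mul_le hx hC
    (show 0 < C * (1 + ε₀) ^ (2.53 : ℝ) / (1 - (1 + ε₀) ^ (-7.47 : ℝ)) by positivity)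
  refine ⟨n₁, fun n₀ hn₀ N τ a b c d a' b' c' d' E E' hN hmono hτ0 hE0 hderiv _ _ _ hinit hEb
    hvan hτ ha hb hc _ hd hEm1 _ hE => ?_⟩
  have hstart : τ (n₀ - N) ≤ 0 := hτ0 ▸ le_of_lt_succ_of_nonpos hmono (by omega) le_rfl
  have hQ : (K ^ 30)⁻¹ ≤ 1 := inv_le_one_of_one_le₀ (one_le_pow₀ hK1)
  have hint := integral_energy_le hx hC hQ (by omega) hmono hE0
    (fun t ht => (hderiv 0 t ht).2.2.2.2.continuousWithinAt) hτ
    fun k hk hk' t ht ht' => (hE k hk hk' t ht ht').2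
  rw [hτ0] at hint
  have hE00 : E 0 0 ≤ 0.54 := by
    have h1 := (hEb 0 0 hstart).2
    have h2 := half_sum_sq_le hK hε hε1 ha hb hc hd
    have h3 : 2 * ((0 : ℤ) : ℝ) - (n₀ : ℝ) / 2 = -(n₀ : ℝ) / 2 := by push_cast; ring
    rw [h3] at h1
    have h4 : C * (1 + ε₀) ^ (-(n₀ : ℝ) / 2) * ∫ s in (τ (n₀ - N))..0, E 0 s ≤ 0.01 :=
      (mul_le_mul_of_nonneg_left hint (by positivity)).trans (hn₁ n₀ hn₀)
    norm_num at h2 h4 ⊢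
    linarith
  have hhigh : ∀ m : ℕ, 1 ≤ m →
      E m 0 ≤ (K ^ 30)⁻¹ * (1 + ε₀) ^ (-10 * (m : ℝ) + 0.02) := by
    intro m hm
    rcases hN.eq_or_lt with rfl | hN
    · rw [sub_self] at hinit
      have h := (hinit m (by omega)).2.2.2.2
      rw [hτ0] at h
      rw [h]
      positivity
    · have h := (hE 0 (by omega) le_rfl 0
        ((hτ (0 - 1) (by omega) (by omega)).2) hτ0.ge).2.2 m hm
      rw [zero_add] at h
      refine h.trans_eq ?_
      norm_num
  have hE1 : E 1 0 ≤ (K ^ 30)⁻¹ := by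
    refine (hhigh 1 le_rfl).trans (mul_le_of_le_one_right (by positivity) ?_)
    exact Real.rpow_le_one_of_one_le_of_nonpos hx.le (by norm_num)
  refine ⟨fun m hm => ?_, ?_, fun m hm => ?_, ?_⟩
  · have hexp : (1 + ε₀) ^ (-(0.08 : ℝ)) * ((K ^ 10)⁻¹ * (1 + ε₀) ^ ((m : ℝ) / 10)) =
        (K ^ 10)⁻¹ * (1 + ε₀) ^ ((m : ℝ) / 10 - 0.08) := by
      rw [mul_left_comm, ← Real.rpow_add hx0]
      congr 2
      ring
    rw [hexp]
    rcases hN.eq_or_lt with rfl | hN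
    · rw [(hvan (1 - m) (by omega) 0 hstart).2.2.2.2]
      positivity
    · rcases hm.eq_or_lt with rfl | hm
      · have h1 : E (1 - ((2 : ℕ) : ℤ)) 0 ≤ (K ^ 10)⁻¹ := by
          refine hEm1.trans ?_
          gcongr ?_⁻¹
          exact pow_le_pow_right₀ hK1 (by norm_num)
        refine h1.trans (le_mul_of_one_le_right (by positivity) ?_)
        exact Real.one_le_rpow hx.le (by norm_num)
      · have h := (hE 0 (by omega) le_rfl 0
          ((hτ (0 - 1) (by omega) (by omega)).2) hτ0.ge).1 (m - 1) (by omega)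
        rw [show (0 : ℤ) - ((m - 1 : ℕ) : ℤ) = 1 - m by omega] at h
        refine h.trans_eq ?_
        rw [Nat.cast_sub (by omega)]
        congr 2
        norm_num
        ring
  · have h : (K ^ 30)⁻¹ ≤ (10 ^ 30 : ℝ)⁻¹ := by gcongr
    norm_num at h hE00 ⊢
    linarith
  · have h := hhigh (1 + m) (by omega)
    push_cast at h
    refine h.trans_eq ?_
    rw [mul_left_comm, ← Real.rpow_add hx0]
    congr 2
    ring
  · have h1 := (hEb 1 0 hstart).1
    have h2 : d 1 0 ^ 2 ≤ (Real.sqrt 2 * (K ^ 15)⁻¹) ^ 2 := by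
      rw [mul_pow, Real.sq_sqrt (by norm_num), inv_pow, ← pow_mul]
      nlinarith [sq_nonneg (a 1 0), sq_nonneg (b 1 0), sq_nonneg (c 1 0)]
    exact abs_le_of_sq_le_sq h2 (by positivity)
end

section
/- Under the rescaled-system hypotheses (i)–(ix), for every integer m there exists a constant C_m > 0 depending only on ε₀, C and m such that ∫_{τ_{n₀−N}}^{0} Ẽ_m(t) dt ≤ C_m. -/
open MeasureTheory intervalIntegral in
/-- If on the `i`-th of consecutive intervals `f` is at most `M i`, the length is at most `L i`, and
`M i * L i ≤ A * r ^ i`, then the integral of `f` over their union is at most `A * (1 - r)⁻¹`. -/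
theorem integral_le_geom_sum {f : ℝ → ℝ} {s : ℕ → ℝ} {n : ℕ} {M L : ℕ → ℝ} {A r : ℝ}
    (hs : ∀ i < n, s (i + 1) ≤ s i)
    (hf : ∀ i < n, IntervalIntegrable f volume (s (i + 1)) (s i))
    (hM : ∀ i < n, ∀ t, s (i + 1) ≤ t → t ≤ s i → f t ≤ M i)
    (hL : ∀ i < n, s i - s (i + 1) ≤ L i)
    (hM0 : ∀ i < n, 0 ≤ M i) (hML : ∀ i < n, M i * L i ≤ A * r ^ i)
    (hA : 0 ≤ A) (hr : 0 ≤ r) (hr' : r < 1) :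
    (∫ t in (s n)..(s 0), f t) ≤ A * (1 - r)⁻¹ := by
  have hsum : (∫ t in (s n)..(s 0), f t) = ∑ i ∈ Finset.range n, ∫ t in (s (i + 1))..(s i), f t := by
    rw [integral_symm, ← sum_integral_adjacent_intervals fun i hi => (hf i hi).symm,
      ← Finset.sum_neg_distrib]
    exact Finset.sum_congr rfl fun i _ => (integral_symm _ _).symm
  rw [hsum]
  calc ∑ i ∈ Finset.range n, ∫ t in (s (i + 1))..(s i), f t
      ≤ ∑ i ∈ Finset.range n, A * r ^ i := by
        refine Finset.sum_le_sum fun i hi => ?_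
        have hi := Finset.mem_range.1 hi
        calc (∫ t in (s (i + 1))..(s i), f t)
            ≤ ∫ _t in (s (i + 1))..(s i), M i :=
              integral_mono_on (hs i hi) (hf i hi) intervalIntegrable_const
                fun t ht => hM i hi t ht.1 ht.2
          _ = M i * (s i - s (i + 1)) := by
              rw [intervalIntegral.integral_const, smul_eq_mul, mul_comm]
          _ ≤ M i * L i := mul_le_mul_of_nonneg_left (hL i hi) (hM0 i hi)
          _ ≤ A * r ^ i := hML i hi
    _ = A * ∑ i ∈ Finset.range n, r ^ i := (Finset.mul_sum ..).symm
    _ ≤ A * (1 - r)⁻¹ := by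
        refine mul_le_mul_of_nonneg_left ?_ hA
        rw [← tsum_geometric_of_lt_one hr hr']
        exact (summable_geometric_of_lt_one hr hr').sum_le_tsum _ fun i _ => pow_nonneg hr i

/-- The three energy bounds available at scale `k` (far below, at, and above `k`) combine into
a single bound for every mode `m`. -/
theorem energy_le_of_scale_bounds {ρ K : ℝ} (hρ : 1 ≤ ρ) (hK : 1 ≤ K) {e : ℤ → ℝ} {k : ℤ}
    (he : ∀ m, 0 ≤ e m) (hk : k ≤ 0)
    (hlow : ∀ m : ℕ, 2 ≤ m →
      e (k - (m : ℤ)) ≤ (K ^ 10)⁻¹ * ρ ^ ((m : ℝ) / 10 + |(k : ℝ) - 1| / 50))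
    (hmid : e (k - 1) + e k ≤ ρ ^ (|(k : ℝ) - 1| / 50))
    (hhigh : ∀ m : ℕ, 1 ≤ m →
      e (k + (m : ℤ)) ≤ (K ^ 30)⁻¹ * ρ ^ (-10 * (m : ℝ) + |(k : ℝ) - 1| / 50)) (m : ℤ) :
    e m ≤ ρ ^ (10 * |(m : ℝ)| + 10 * (k : ℝ) + |(k : ℝ) - 1| / 50) := by
  have hinv : ∀ (p : ℕ) (x y : ℝ), x ≤ y → (K ^ p)⁻¹ * ρ ^ x ≤ ρ ^ y := fun p x y hxy =>
    (mul_le_of_le_one_left (by positivity) (inv_le_one_of_one_le₀ (one_le_pow₀ hK))).trans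
      (Real.rpow_le_rpow_of_exponent_le hρ hxy)
  have hk' : (k : ℝ) ≤ 0 := by exact_mod_cast hk
  have habs := neg_abs_le (m : ℝ)
  have habs' := le_abs_self (m : ℝ)
  rcases lt_or_ge k m with h | h
  · obtain ⟨j, hj⟩ := Int.eq_ofNat_of_zero_le (sub_nonneg.2 h.le)
    have hm : m = k + (j : ℤ) := by omega
    have hmr : (m : ℝ) = k + j := by exact_mod_cast hm
    have hb := hhigh j (by omega)
    rw [← hm] at hb
    exact hb.trans (hinv _ _ _ (by linarith))
  · rcases le_or_gt (k - 1) m with h1 | h1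
    · have hmk : (k : ℝ) - 1 ≤ m := by exact_mod_cast h1
      have hkm : (m : ℝ) ≤ k := by exact_mod_cast h
      have hb : e m ≤ ρ ^ (|(k : ℝ) - 1| / 50) := by
        have h0 := he k
        have h0' := he (k - 1)
        obtain rfl | rfl : m = k ∨ m = k - 1 := by omega
        all_goals linarith
      refine hb.trans (Real.rpow_le_rpow_of_exponent_le hρ ?_)
      linarith
    · obtain ⟨j, hj⟩ := Int.eq_ofNat_of_zero_le (sub_nonneg.2 h)
      have hm : m = k - (j : ℤ) := by omega
      have hmr : (m : ℝ) = k - j := by exact_mod_cast hm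
      have hb := hlow j (by omega)
      rw [← hm] at hb
      have hj0 : (0 : ℝ) ≤ j := Nat.cast_nonneg j
      exact hb.trans (hinv _ _ _ (by linarith))


/-- Cumulative energy bound for the rescaled system: for every integer `m` there is a
constant `Cm` depending only on `ε₀`, `C` and `m` with `∫_{τ_{n₀-N}}^0 Ẽ_m ≤ Cm`. -/
theorem rescaled_cumulative_energy_bound (ε₀ : ℝ) (hε₀ : 0 < ε₀) (hε₀' : ε₀ < 1) :
    ∃ K₀ : ℝ, ∃ Cm : ℝ → ℤ → ℝ, (∀ (C : ℝ) (m : ℤ), 0 < C → 0 < Cm C m) ∧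
      ∀ K : ℝ, K₀ ≤ K →
      ∃ ε₁ : ℝ, 0 < ε₁ ∧ ∀ ε : ℝ, 0 < ε → ε ≤ ε₁ →
        ∀ C : ℝ, 0 < C →
          ∃ n₁ : ℤ, ∀ n₀ : ℤ, n₁ ≤ n₀ →
            ∀ (N : ℤ) (τ : ℤ → ℝ) (a b c d a' b' c' d' E E' : ℤ → ℝ → ℝ),
            n₀ ≤ N →
            (∀ k : ℤ, n₀ - N ≤ k → k < 0 → τ k < τ (k + 1)) →
            τ 0 = 0 →
            (∀ (k : ℤ) (t : ℝ), τ (n₀ - N) ≤ t → 0 ≤ E k t) →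
            (∀ (k : ℤ) (t : ℝ), τ (n₀ - N) ≤ t →
              HasDerivWithinAt (a k) (a' k t) (Set.Ici (τ (n₀ - N))) t ∧
              HasDerivWithinAt (b k) (b' k t) (Set.Ici (τ (n₀ - N))) t ∧
              HasDerivWithinAt (c k) (c' k t) (Set.Ici (τ (n₀ - N))) t ∧
              HasDerivWithinAt (d k) (d' k t) (Set.Ici (τ (n₀ - N))) t ∧
              HasDerivWithinAt (E k) (E' k t) (Set.Ici (τ (n₀ - N))) t) →
            (∀ k : ℤ,
              ContinuousOn (a' k) (Set.Ici (τ (n₀ - N))) ∧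
              ContinuousOn (b' k) (Set.Ici (τ (n₀ - N))) ∧
              ContinuousOn (c' k) (Set.Ici (τ (n₀ - N))) ∧
              ContinuousOn (d' k) (Set.Ici (τ (n₀ - N))) ∧
              ContinuousOn (E' k) (Set.Ici (τ (n₀ - N)))) →
            (∀ T : ℝ, ∃ M : ℝ, ∀ (k : ℤ) (t : ℝ), τ (n₀ - N) ≤ t → t ≤ T →
              (1 + (1 + ε₀) ^ (10 * (k : ℝ))) * (|a k t| + |b k t| + |c k t| + |d k t|) ≤ M ∧
              (1 + (1 + ε₀) ^ (10 * (k : ℝ))) * Real.sqrt (E k t) ≤ M) →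
            (∀ (k : ℤ) (t : ℝ), τ (n₀ - N) ≤ t →
              |a' k t - (1 + ε₀) ^ (5 * (k : ℝ) / 2) *
                  (-(ε ^ 2)⁻¹ * c k t * d k t - ε * a k t * b k t -
                    ε ^ 2 * Real.exp (-K ^ 10) * a k t * c k t + K * d (k - 1) t ^ 2)| ≤
                C * (1 + ε₀) ^ (2 * (k : ℝ) - (n₀ : ℝ) / 2) * Real.sqrt (E k t) ∧
              |b' k t - (1 + ε₀) ^ (5 * (k : ℝ) / 2) *
                  (ε * a k t ^ 2 - ε⁻¹ * K ^ 10 * c k t ^ 2)| ≤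
                C * (1 + ε₀) ^ (2 * (k : ℝ) - (n₀ : ℝ) / 2) * Real.sqrt (E k t) ∧
              |c' k t - (1 + ε₀) ^ (5 * (k : ℝ) / 2) *
                  (ε ^ 2 * Real.exp (-K ^ 10) * a k t ^ 2 + ε⁻¹ * K ^ 10 * b k t * c k t)| ≤
                C * (1 + ε₀) ^ (2 * (k : ℝ) - (n₀ : ℝ) / 2) * Real.sqrt (E k t) ∧
              |d' k t - (1 + ε₀) ^ (5 * (k : ℝ) / 2) *
                  ((ε ^ 2)⁻¹ * c k t * a k t -
                    (1 + ε₀) ^ ((5 : ℝ) / 2) * K * d k t * a (k + 1) t)| ≤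
                C * (1 + ε₀) ^ (2 * (k : ℝ) - (n₀ : ℝ) / 2) * Real.sqrt (E k t) ∧
              E' k t ≤ K * (1 + ε₀) ^ (5 * (k : ℝ) / 2) *
                (d (k - 1) t ^ 2 * a k t - (1 + ε₀) ^ ((5 : ℝ) / 2) * d k t ^ 2 * a (k + 1) t)) →
            (∀ k : ℤ, n₀ - N < k →
              a k (τ (n₀ - N)) = 0 ∧ b k (τ (n₀ - N)) = 0 ∧ c k (τ (n₀ - N)) = 0 ∧
                d k (τ (n₀ - N)) = 0 ∧ E k (τ (n₀ - N)) = 0) →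
            (∀ (k : ℤ) (t : ℝ), τ (n₀ - N) ≤ t →
              (a k t ^ 2 + b k t ^ 2 + c k t ^ 2 + d k t ^ 2) / 2 ≤ E k t ∧
              E k t ≤ (a k t ^ 2 + b k t ^ 2 + c k t ^ 2 + d k t ^ 2) / 2 +
                C * (1 + ε₀) ^ (2 * (k : ℝ) - (n₀ : ℝ) / 2) * ∫ s in (τ (n₀ - N))..t, E k s) →
            (∀ k : ℤ, k < n₀ - N → ∀ t : ℝ, τ (n₀ - N) ≤ t →
              a k t = 0 ∧ b k t = 0 ∧ c k t = 0 ∧ d k t = 0 ∧ E k t = 0) →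
            (∀ k : ℤ, n₀ - N ≤ k → k ≤ 0 →
              -C * (1 + ε₀) ^ ((5 / 2 + 1 / 100) * |(k : ℝ)|) ≤ τ k ∧ τ k ≤ 0) →
            a 0 0 = 1 →
            |b 0 0| ≤ ε / 10 ^ 5 →
            |c 0 0| ≤ Real.exp (-K ^ 10) * ε ^ 2 / 10 ^ 5 →
            -(1 + ε₀) ^ (-(n₀ : ℝ) / 4) ≤ c 0 0 →
            |d 0 0| ≤ (K ^ 10)⁻¹ →
            E (-1) 0 ≤ (K ^ 20)⁻¹ →
            (n₀ < N →
              ε / 10 ^ 5 ≤ b (-1) 0 ∧ b (-1) 0 ≤ 10 ^ 5 * ε ∧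
              Real.exp (K ^ 9) * ε ^ 2 ≤ c (-1) 0 ∧ c (-1) 0 ≤ Real.exp (K ^ 10) * ε ^ 2) →
            (∀ k : ℤ, n₀ - N < k → k ≤ 0 → ∀ t : ℝ, τ (k - 1) ≤ t → t ≤ τ k →
              (∀ m : ℕ, 2 ≤ m →
                E (k - (m : ℤ)) t ≤ (K ^ 10)⁻¹ * (1 + ε₀) ^ ((m : ℝ) / 10 + |(k : ℝ) - 1| / 50)) ∧
              E (k - 1) t + E k t ≤ (1 + ε₀) ^ (|(k : ℝ) - 1| / 50) ∧
              (∀ m : ℕ, 1 ≤ m →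
                E (k + (m : ℤ)) t ≤ (K ^ 30)⁻¹ * (1 + ε₀) ^ (-10 * (m : ℝ) + |(k : ℝ) - 1| / 50))) →
            ∀ m : ℤ, (∫ t in (τ (n₀ - N))..(0 : ℝ), E m t) ≤ Cm C m := by
  have hρ : 1 < 1 + ε₀ := by linarith
  have hρ0 : 0 < 1 + ε₀ := by linarith
  have hr : (1 + ε₀)⁻¹ < 1 := inv_lt_one_of_one_lt₀ hρ
  have hr0 : 0 ≤ (1 + ε₀)⁻¹ := by positivity
  refine ⟨1, fun C m => C * (1 + ε₀) ^ (10 * |(m : ℝ)| + 10) * (1 - (1 + ε₀)⁻¹)⁻¹,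
    fun C m hC => mul_pos (by positivity) (inv_pos.2 (sub_pos.2 hr)), fun K hK =>
    ⟨1, one_pos, fun ε _ _ C hC => ⟨0, ?_⟩⟩⟩
  intro n₀ _ N τ a b c d a' b' c' d' E E' hN hτ hτ0 hE hderiv _ _ _ _ _ _ hτC _ _ _ _ _ _ _ hener m
  obtain ⟨n, hn⟩ := Int.eq_ofNat_of_zero_le (sub_nonneg.2 hN)
  have hn' : n₀ - N = -(n : ℤ) := by omega
  rw [hn'] at hτ hE hderiv hτC hener ⊢
  have hstep : ∀ i < n, τ (-((i + 1 : ℕ) : ℤ)) ≤ τ (-(i : ℤ)) := fun i hi => by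
    have h := hτ (-((i + 1 : ℕ) : ℤ)) (by omega) (by omega)
    rw [show -((i + 1 : ℕ) : ℤ) + 1 = -(i : ℤ) by omega] at h
    exact h.le
  have hmin : ∀ i ≤ n, τ (-(n : ℤ)) ≤ τ (-(i : ℤ)) := fun i hi =>
    Nat.decreasingInduction' (P := fun i => τ (-(n : ℤ)) ≤ τ (-(i : ℤ)))
      (fun j hj _ ih => ih.trans (hstep j hj)) hi le_rfl
  have hcont : ContinuousOn (E m) (Set.Ici (τ (-(n : ℤ)))) := fun t ht =>
    (hderiv m t ht).2.2.2.2.continuousWithinAt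
  have key := integral_le_geom_sum (f := E m) (s := fun i => τ (-(i : ℤ))) (n := n)
    (M := fun i => (1 + ε₀) ^ (10 * |(m : ℝ)| - 10 * (i : ℝ) + ((i : ℝ) + 1) / 50))
    (L := fun i => C * (1 + ε₀) ^ ((5 / 2 + 1 / 100) * ((i : ℝ) + 1)))
    (A := C * (1 + ε₀) ^ (10 * |(m : ℝ)| + 10)) (r := (1 + ε₀)⁻¹) hstep ?_ ?_ ?_
    (fun i _ => by positivity) ?_ (by positivity) hr0 hr
  · simpa [hτ0] using key
  · intro i hi
    refine (hcont.mono fun t ht => ?_).intervalIntegrable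
    rw [Set.uIcc_of_le (hstep i hi)] at ht
    exact (hmin (i + 1) hi).trans ht.1
  · intro i hi t ht1 ht2
    have hb := hener (-(i : ℤ)) (by omega) (by omega) t
      (by rwa [show -(i : ℤ) - 1 = -((i + 1 : ℕ) : ℤ) by omega]) ht2
    have h := energy_le_of_scale_bounds (e := fun k => E k t) hρ.le hK
      (fun k => hE k t ((hmin (i + 1) hi).trans ht1)) (by omega) hb.1 hb.2.1 hb.2.2 m
    have habs : |((-(i : ℤ) : ℤ) : ℝ) - 1| = (i : ℝ) + 1 := by
      push_cast
      rw [abs_of_nonpos] <;> linarith [(Nat.cast_nonneg i : (0 : ℝ) ≤ i)]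
    rw [habs] at h
    refine h.trans_eq (congrArg _ ?_)
    push_cast
    ring
  · intro i hi
    have h1 := (hτC (-((i + 1 : ℕ) : ℤ)) (by omega) (by omega)).1
    have h2 := (hτC (-(i : ℤ)) (by omega) (by omega)).2
    have habs : |((-((i + 1 : ℕ) : ℤ) : ℤ) : ℝ)| = (i : ℝ) + 1 := by
      push_cast
      rw [abs_of_nonpos] <;> linarith [(Nat.cast_nonneg i : (0 : ℝ) ≤ i)]
    rw [habs] at h1
    linarith
  · intro i _
    rw [inv_pow, ← Real.rpow_natCast, ← Real.rpow_neg hρ0.le, mul_left_comm, mul_assoc,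
      ← Real.rpow_add hρ0, ← Real.rpow_add hρ0]
    refine mul_le_mul_of_nonneg_left (Real.rpow_le_rpow_of_exponent_le hρ.le ?_) hC.le
    linarith [(Nat.cast_nonneg i : (0 : ℝ) ≤ i)]
end

section
/- Under the rescaled-system hypotheses (i)–(ix), with T₁ defined as below, there exists a constant C′ > 0 depending only on ε₀ and C such that for every k ∈ {−1, 0, 1} and every 0 ≤ t ≤ T₁ one has |Ẽ_k(t) − ½(a_k(t)² + b_k(t)² + c_k(t)² + d_k(t)²)| ≤ C′(1+ε₀)^{−n₀/2}. -/
open MeasureTheory Set in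
/-- Consecutive intervals with geometrically decaying contributions have a bounded total integral. -/
theorem integral_le_of_geometric_steps {f : ℝ → ℝ} {σ : ℕ → ℝ} {B r : ℝ} {n : ℕ}
    (hr0 : 0 ≤ r) (hr1 : r < 1) (hB : 0 ≤ B)
    (hf : ContinuousOn f (Ici (σ n)))
    (hσ : ∀ i < n, σ (i + 1) ≤ σ i)
    (hbound : ∀ i < n, ∀ s, σ (i + 1) ≤ s → s ≤ σ i → f s * (σ i - σ (i + 1)) ≤ B * r ^ i) :
    ∫ s in (σ n)..(σ 0), f s ≤ B * (1 - r)⁻¹ := by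
  have hanti : ∀ i ≤ n, σ n ≤ σ i := by
    intro i hi
    induction hi using Nat.decreasingInduction with
    | self => exact le_rfl
    | of_succ k hk ih => exact ih.trans (hσ k hk)
  have hint : ∀ x y, σ n ≤ x → σ n ≤ y → IntervalIntegrable f volume x y := by
    intro x y hx hy
    exact (hf.mono fun z hz => (le_min hx hy).trans hz.1).intervalIntegrable
  have step : ∀ i < n, ∫ s in (σ (i + 1))..(σ i), f s ≤ B * r ^ i := by
    intro i hi
    rcases (hσ i hi).eq_or_lt with h | h
    · rw [h, intervalIntegral.integral_same]; positivity
    · have hpos : 0 < σ i - σ (i + 1) := sub_pos.2 h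
      have := intervalIntegral.integral_mono_on h.le
        (hint _ _ (hanti _ hi) (hanti _ hi.le))
        (intervalIntegrable_const (c := B * r ^ i / (σ i - σ (i + 1))) (μ := volume))
        (fun s hs => (le_div_iff₀ hpos).2 (hbound i hi s hs.1 hs.2))
      refine this.trans (le_of_eq ?_)
      rw [intervalIntegral.integral_const, smul_eq_mul]
      field_simp
  have key : ∀ i ≤ n, ∫ s in (σ i)..(σ 0), f s ≤ B * ∑ l ∈ Finset.range i, r ^ l := by
    intro i
    induction i with
    | zero => simp
    | succ i ih =>
      intro hi
      rw [← intervalIntegral.integral_add_adjacent_intervals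
        (hint _ _ (hanti _ hi) (hanti i (by omega))) (hint _ _ (hanti i (by omega))
          (hanti 0 (by omega))), Finset.sum_range_succ, mul_add, add_comm]
      exact add_le_add (ih (by omega)) (step i hi)
  refine (key n le_rfl).trans (mul_le_mul_of_nonneg_left ?_ hB)
  rw [← tsum_geometric_of_lt_one hr0 hr1]
  exact (summable_geometric_of_lt_one hr0 hr1).sum_le_tsum _ fun i _ => by positivity

/-- Almost all energy in the primary modes: for `k ∈ {-1,0,1}` and `0 ≤ t ≤ T₁`,
`Ẽ_k(t)` equals `(a_k² + b_k² + c_k² + d_k²)/2` up to `C′ (1+ε₀)^{-n₀/2}`, where `C′`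
depends only on `ε₀` and `C`. -/
theorem rescaled_energy_in_primary_modes (ε₀ : ℝ) (hε₀ : 0 < ε₀) (hε₀' : ε₀ < 1) :
    ∃ K₀ : ℝ, ∃ C' : ℝ → ℝ, (∀ C : ℝ, 0 < C → 0 < C' C) ∧
      ∀ K : ℝ, K₀ ≤ K →
      ∃ ε₁ : ℝ, 0 < ε₁ ∧ ∀ ε : ℝ, 0 < ε → ε ≤ ε₁ →
        ∀ C : ℝ, 0 < C →
          ∃ n₁ : ℤ, ∀ n₀ : ℤ, n₁ ≤ n₀ →
            ∀ (N : ℤ) (τ : ℤ → ℝ) (a b c d a' b' c' d' E E' : ℤ → ℝ → ℝ) (T₁ : ℝ),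
            n₀ ≤ N →
            (∀ k : ℤ, n₀ - N ≤ k → k < 0 → τ k < τ (k + 1)) →
            τ 0 = 0 →
            (∀ (k : ℤ) (t : ℝ), τ (n₀ - N) ≤ t → 0 ≤ E k t) →
            (∀ (k : ℤ) (t : ℝ), τ (n₀ - N) ≤ t →
              HasDerivWithinAt (a k) (a' k t) (Set.Ici (τ (n₀ - N))) t ∧
              HasDerivWithinAt (b k) (b' k t) (Set.Ici (τ (n₀ - N))) t ∧
              HasDerivWithinAt (c k) (c' k t) (Set.Ici (τ (n₀ - N))) t ∧
              HasDerivWithinAt (d k) (d' k t) (Set.Ici (τ (n₀ - N))) t ∧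
              HasDerivWithinAt (E k) (E' k t) (Set.Ici (τ (n₀ - N))) t) →
            (∀ k : ℤ,
              ContinuousOn (a' k) (Set.Ici (τ (n₀ - N))) ∧
              ContinuousOn (b' k) (Set.Ici (τ (n₀ - N))) ∧
              ContinuousOn (c' k) (Set.Ici (τ (n₀ - N))) ∧
              ContinuousOn (d' k) (Set.Ici (τ (n₀ - N))) ∧
              ContinuousOn (E' k) (Set.Ici (τ (n₀ - N)))) →
            (∀ T : ℝ, ∃ M : ℝ, ∀ (k : ℤ) (t : ℝ), τ (n₀ - N) ≤ t → t ≤ T →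
              (1 + (1 + ε₀) ^ (10 * (k : ℝ))) * (|a k t| + |b k t| + |c k t| + |d k t|) ≤ M ∧
              (1 + (1 + ε₀) ^ (10 * (k : ℝ))) * Real.sqrt (E k t) ≤ M) →
            (∀ (k : ℤ) (t : ℝ), τ (n₀ - N) ≤ t →
              |a' k t - (1 + ε₀) ^ (5 * (k : ℝ) / 2) *
                  (-(ε ^ 2)⁻¹ * c k t * d k t - ε * a k t * b k t -
                    ε ^ 2 * Real.exp (-K ^ 10) * a k t * c k t + K * d (k - 1) t ^ 2)| ≤
                C * (1 + ε₀) ^ (2 * (k : ℝ) - (n₀ : ℝ) / 2) * Real.sqrt (E k t) ∧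
              |b' k t - (1 + ε₀) ^ (5 * (k : ℝ) / 2) *
                  (ε * a k t ^ 2 - ε⁻¹ * K ^ 10 * c k t ^ 2)| ≤
                C * (1 + ε₀) ^ (2 * (k : ℝ) - (n₀ : ℝ) / 2) * Real.sqrt (E k t) ∧
              |c' k t - (1 + ε₀) ^ (5 * (k : ℝ) / 2) *
                  (ε ^ 2 * Real.exp (-K ^ 10) * a k t ^ 2 + ε⁻¹ * K ^ 10 * b k t * c k t)| ≤
                C * (1 + ε₀) ^ (2 * (k : ℝ) - (n₀ : ℝ) / 2) * Real.sqrt (E k t) ∧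
              |d' k t - (1 + ε₀) ^ (5 * (k : ℝ) / 2) *
                  ((ε ^ 2)⁻¹ * c k t * a k t -
                    (1 + ε₀) ^ ((5 : ℝ) / 2) * K * d k t * a (k + 1) t)| ≤
                C * (1 + ε₀) ^ (2 * (k : ℝ) - (n₀ : ℝ) / 2) * Real.sqrt (E k t) ∧
              E' k t ≤ K * (1 + ε₀) ^ (5 * (k : ℝ) / 2) *
                (d (k - 1) t ^ 2 * a k t - (1 + ε₀) ^ ((5 : ℝ) / 2) * d k t ^ 2 * a (k + 1) t)) →
            (∀ k : ℤ, n₀ - N < k →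
              a k (τ (n₀ - N)) = 0 ∧ b k (τ (n₀ - N)) = 0 ∧ c k (τ (n₀ - N)) = 0 ∧
                d k (τ (n₀ - N)) = 0 ∧ E k (τ (n₀ - N)) = 0) →
            (∀ (k : ℤ) (t : ℝ), τ (n₀ - N) ≤ t →
              (a k t ^ 2 + b k t ^ 2 + c k t ^ 2 + d k t ^ 2) / 2 ≤ E k t ∧
              E k t ≤ (a k t ^ 2 + b k t ^ 2 + c k t ^ 2 + d k t ^ 2) / 2 +
                C * (1 + ε₀) ^ (2 * (k : ℝ) - (n₀ : ℝ) / 2) * ∫ s in (τ (n₀ - N))..t, E k s) →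
            (∀ k : ℤ, k < n₀ - N → ∀ t : ℝ, τ (n₀ - N) ≤ t →
              a k t = 0 ∧ b k t = 0 ∧ c k t = 0 ∧ d k t = 0 ∧ E k t = 0) →
            (∀ k : ℤ, n₀ - N ≤ k → k ≤ 0 →
              -C * (1 + ε₀) ^ ((5 / 2 + 1 / 100) * |(k : ℝ)|) ≤ τ k ∧ τ k ≤ 0) →
            a 0 0 = 1 →
            |b 0 0| ≤ ε / 10 ^ 5 →
            |c 0 0| ≤ Real.exp (-K ^ 10) * ε ^ 2 / 10 ^ 5 →
            -(1 + ε₀) ^ (-(n₀ : ℝ) / 4) ≤ c 0 0 →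
            |d 0 0| ≤ (K ^ 10)⁻¹ →
            E (-1) 0 ≤ (K ^ 20)⁻¹ →
            (n₀ < N →
              ε / 10 ^ 5 ≤ b (-1) 0 ∧ b (-1) 0 ≤ 10 ^ 5 * ε ∧
              Real.exp (K ^ 9) * ε ^ 2 ≤ c (-1) 0 ∧ c (-1) 0 ≤ Real.exp (K ^ 10) * ε ^ 2) →
            (∀ k : ℤ, n₀ - N < k → k ≤ 0 → ∀ t : ℝ, τ (k - 1) ≤ t → t ≤ τ k →
              (∀ m : ℕ, 2 ≤ m →
                E (k - (m : ℤ)) t ≤ (K ^ 10)⁻¹ * (1 + ε₀) ^ ((m : ℝ) / 10 + |(k : ℝ) - 1| / 50)) ∧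
              E (k - 1) t + E k t ≤ (1 + ε₀) ^ (|(k : ℝ) - 1| / 50) ∧
              (∀ m : ℕ, 1 ≤ m →
                E (k + (m : ℤ)) t ≤ (K ^ 30)⁻¹ * (1 + ε₀) ^ (-10 * (m : ℝ) + |(k : ℝ) - 1| / 50))) →
            IsGreatest {T : ℝ | T ∈ Set.Icc (0 : ℝ) 100 ∧ ∀ t : ℝ, 0 ≤ t → t ≤ T →
              (∀ m : ℕ, 2 ≤ m → E (1 - (m : ℤ)) t ≤ (K ^ 10)⁻¹ * (1 + ε₀) ^ ((m : ℝ) / 10)) ∧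
              E 0 t + E 1 t ≤ 1 ∧
              (∀ m : ℕ, 1 ≤ m → E (1 + (m : ℤ)) t ≤ (K ^ 30)⁻¹ * (1 + ε₀) ^ (-10 * (m : ℝ))) ∧
              |d 1 t| ≤ (K ^ 10)⁻¹ / 2} T₁ →
            ∀ k : ℤ, (k = -1 ∨ k = 0 ∨ k = 1) → ∀ t : ℝ, 0 ≤ t → t ≤ T₁ →
              |E k t - (a k t ^ 2 + b k t ^ 2 + c k t ^ 2 + d k t ^ 2) / 2| ≤
                C' C * (1 + ε₀) ^ (-(n₀ : ℝ) / 2) := by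
  set q : ℝ := 1 + ε₀ with hq
  have hq0 : 0 < q := by linarith
  have hq1 : 1 ≤ q := by linarith
  refine ⟨1, fun C => C * q ^ (2 : ℝ) * (C * q ^ (23 : ℝ) * (1 - q⁻¹)⁻¹ + 200), ?_, ?_⟩
  · intro C hC
    have : q⁻¹ < 1 := inv_lt_one_of_one_lt₀ (by linarith)
    have : 0 < 1 - q⁻¹ := by linarith
    positivity
  intro K hK
  refine ⟨1, one_pos, fun ε _ _ C hC => ⟨0, ?_⟩⟩
  intro n₀ _ N τ a b c d a' b' c' d' E E' T₁ hN hτ hτ0 hE hder _ _ _ _ hprim _ hτC _ _ _ _ _ _ _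
    hpast hT k hk t ht0 htT
  have hr1 : q⁻¹ < 1 := inv_lt_one_of_one_lt₀ (by linarith)
  have hKinv : ∀ p : ℕ, (K ^ p)⁻¹ ≤ 1 := fun p => inv_le_one_of_one_le₀ (one_le_pow₀ hK)
  have hmono : ∀ x y : ℝ, x ≤ y → q ^ x ≤ q ^ y := fun x y h => Real.rpow_le_rpow_of_exponent_le hq1 h
  have hKq : ∀ (p : ℕ) (x : ℝ), (K ^ p)⁻¹ * q ^ x ≤ q ^ x := fun p x =>
    mul_le_of_le_one_left (by positivity) (hKinv p)
  obtain ⟨n, hn⟩ : ∃ n : ℕ, n₀ - N = -(n : ℤ) := ⟨(N - n₀).toNat, by omega⟩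
  rw [hn] at hτ hE hder hprim hτC hpast
  have hstep : ∀ i < n, τ (-((i + 1 : ℕ) : ℤ)) ≤ τ (-(i : ℤ)) := by
    intro i hi
    have := hτ (-((i + 1 : ℕ) : ℤ)) (by omega) (by omega)
    rw [show -((i + 1 : ℕ) : ℤ) + 1 = -(i : ℤ) by omega] at this
    exact this.le
  have hstart : ∀ i ≤ n, τ (-(n : ℤ)) ≤ τ (-(i : ℤ)) := by
    intro i hi
    induction hi using Nat.decreasingInduction with
    | self => exact le_rfl
    | of_succ i hi ih => exact ih.trans (hstep i hi)
  have hstart0 : τ (-(n : ℤ)) ≤ 0 := (hτC _ le_rfl (by omega)).2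
  have hcont : ContinuousOn (E k) (Set.Ici (τ (-(n : ℤ)))) := fun s hs =>
    (hder k s hs).2.2.2.2.continuousWithinAt
  have hEpast : ∀ i < n, ∀ s, τ (-((i + 1 : ℕ) : ℤ)) ≤ s → s ≤ τ (-(i : ℤ)) →
      E k s ≤ q ^ (20 - 9.98 * (i : ℝ)) := by
    intro i hi s hs1 hs2
    have hs0 : τ (-(n : ℤ)) ≤ s := (hstart _ hi).trans hs1
    obtain ⟨-, hmid, hnext⟩ := hpast (-(i : ℤ)) (by omega) (by omega) s
      (by rwa [show -(i : ℤ) - 1 = -((i + 1 : ℕ) : ℤ) by omega]) hs2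
    have habs : |((-(i : ℤ) : ℤ) : ℝ) - 1| = i + 1 := by
      push_cast
      rw [abs_of_nonpos (by have : (0 : ℝ) ≤ i := by positivity
                            linarith)]
      ring
    rw [habs] at hmid hnext
    have hi0 : (0 : ℝ) ≤ i := by positivity
    by_cases hm : -(i : ℤ) < k
    · obtain ⟨m, hm'⟩ : ∃ m : ℕ, k = -(i : ℤ) + m := ⟨(k + i).toNat, by omega⟩
      have hmi : (i : ℝ) ≤ m + 1 := by
        have : i ≤ m + 1 := by omega
        exact_mod_cast this
      rw [hm']
      refine (hnext m (by omega)).trans ((hKq _ _).trans (hmono _ _ ?_))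
      linarith
    · have hi1 : (i : ℝ) ≤ 1 := by
        have : i ≤ 1 := by omega
        exact_mod_cast this
      have h1 := hE (-(i : ℤ) - 1) s hs0
      have h2 := hE (-(i : ℤ)) s hs0
      have h3 : E k s ≤ q ^ (((i : ℝ) + 1) / 50) := by
        have : k = -(i : ℤ) ∨ k = -(i : ℤ) - 1 := by omega
        rcases this with h | h <;> rw [h] <;> linarith
      exact h3.trans (hmono _ _ (by linarith))
  have hIpast : ∫ s in (τ (-(n : ℤ)))..0, E k s ≤ C * q ^ (23 : ℝ) * (1 - q⁻¹)⁻¹ := by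
    have := integral_le_of_geometric_steps (f := E k) (σ := fun i : ℕ => τ (-(i : ℤ)))
      (B := C * q ^ (23 : ℝ)) (r := q⁻¹) (n := n) (by positivity) hr1 (by positivity) hcont hstep ?_
    · simpa [hτ0] using this
    intro i hi s hs1 hs2
    have hlen : τ (-(i : ℤ)) - τ (-((i + 1 : ℕ) : ℤ)) ≤ C * q ^ (2.51 * ((i : ℝ) + 1)) := by
      have h1 := (hτC (-(i : ℤ)) (by omega) (by omega)).2
      have h2 := (hτC (-((i + 1 : ℕ) : ℤ)) (by omega) (by omega)).1
      have habs : |((-((i + 1 : ℕ) : ℤ) : ℤ) : ℝ)| = i + 1 := by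
        push_cast
        rw [abs_neg, abs_of_nonneg (by positivity)]
      rw [habs, show (5 / 2 + 1 / 100 : ℝ) = 2.51 by norm_num] at h2
      linarith
    calc E k s * (τ (-(i : ℤ)) - τ (-((i + 1 : ℕ) : ℤ)))
        ≤ q ^ (20 - 9.98 * (i : ℝ)) * (C * q ^ (2.51 * ((i : ℝ) + 1))) :=
          mul_le_mul (hEpast i hi s hs1 hs2) hlen (sub_nonneg.2 (hstep i hi)) (by positivity)
      _ = C * q ^ (20 - 9.98 * (i : ℝ) + 2.51 * ((i : ℝ) + 1)) := by
          rw [Real.rpow_add hq0]; ring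
      _ ≤ C * q ^ (23 + -(i : ℝ)) := by
          refine mul_le_mul_of_nonneg_left (hmono _ _ ?_) hC.le
          have : (0 : ℝ) ≤ i := by positivity
          linarith
      _ = C * q ^ (23 : ℝ) * q⁻¹ ^ i := by
          rw [Real.rpow_add hq0, Real.rpow_neg hq0.le, Real.rpow_natCast, inv_pow]; ring
  obtain ⟨⟨⟨-, hT100⟩, hTb⟩, -⟩ := hT
  have hInow : ∫ s in (0 : ℝ)..t, E k s ≤ 200 := by
    have hnow : ∀ s ∈ Set.Icc 0 t, E k s ≤ 2 := by
      intro s hs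
      obtain ⟨h1, h2, -⟩ := hTb s hs.1 (hs.2.trans htT)
      have h3 := hE 0 s (hstart0.trans hs.1)
      have h4 := hE 1 s (hstart0.trans hs.1)
      rcases hk with rfl | rfl | rfl
      · have h5 := (h1 2 le_rfl).trans ((hKq _ _).trans (hmono _ 1 (by norm_num)))
        rw [Real.rpow_one] at h5
        norm_num at h5
        linarith
      · linarith
      · linarith
    have := intervalIntegral.integral_mono_on ht0
      (hcont.mono fun z hz => hstart0.trans ((le_min le_rfl ht0).trans hz.1)).intervalIntegrable
      (intervalIntegrable_const (c := (2 : ℝ)) (μ := MeasureTheory.volume)) hnow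
    rw [intervalIntegral.integral_const, smul_eq_mul] at this
    linarith
  have hI : ∫ s in (τ (-(n : ℤ)))..t, E k s ≤ C * q ^ (23 : ℝ) * (1 - q⁻¹)⁻¹ + 200 := by
    rw [← intervalIntegral.integral_add_adjacent_intervals (b := 0)
      (hcont.mono fun z hz => (le_min le_rfl hstart0).trans hz.1).intervalIntegrable
      (hcont.mono fun z hz => hstart0.trans ((le_min le_rfl ht0).trans hz.1)).intervalIntegrable]
    exact add_le_add hIpast hInow
  have hI0 : 0 ≤ ∫ s in (τ (-(n : ℤ)))..t, E k s :=
    intervalIntegral.integral_nonneg (hstart0.trans ht0) fun s hs => hE k s hs.1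
  obtain ⟨hlo, hup⟩ := hprim k t (hstart0.trans ht0)
  rw [abs_of_nonneg (by linarith)]
  have hpow : q ^ (2 * (k : ℝ) - (n₀ : ℝ) / 2) ≤ q ^ (2 : ℝ) * q ^ (-(n₀ : ℝ) / 2) := by
    rw [← Real.rpow_add hq0]
    apply hmono
    have : (k : ℝ) ≤ 1 := by
      have : k ≤ 1 := by omega
      exact_mod_cast this
    linarith
  calc E k t - (a k t ^ 2 + b k t ^ 2 + c k t ^ 2 + d k t ^ 2) / 2
      ≤ C * q ^ (2 * (k : ℝ) - (n₀ : ℝ) / 2) * ∫ s in (τ (-(n : ℤ)))..t, E k s := by linarith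
    _ ≤ C * (q ^ (2 : ℝ) * q ^ (-(n₀ : ℝ) / 2)) *
          (C * q ^ (23 : ℝ) * (1 - q⁻¹)⁻¹ + 200) :=
        mul_le_mul (mul_le_mul_of_nonneg_left hpow hC.le) hI hI0 (by positivity)
    _ = C * q ^ (2 : ℝ) * (C * q ^ (23 : ℝ) * (1 - q⁻¹)⁻¹ + 200) * q ^ (-(n₀ : ℝ) / 2) := by ring
end

section
/- Let ξ₁⁰ := (0,1,0), ξ₂⁰ := (−1,−1,0), ξ₃⁰ := (1,0,0) in ℝ³. For every constant C > 0 there exists ε* > 0 such that for all 0 < ε₀ ≤ ε* the following holds: for all (η₁, η₂, η₃) ∈ ℝ³ × ℝ³ × ℝ³ with |η_j − ξ_j⁰| < Cε₀³ for j = 1, 2, 3 and η₁ + η₂ + η₃ = 0, the cross product η₁ × η₂ is nonzero, and, setting u_j := η_j/|η_j| and n := (η₁ × η₂)/|η₁ × η₂|, for every choice of signs σ₁, σ₂, σ₃ ∈ {−1, +1} one has |((u₁ × n) · η₂) σ₁ (1 − (u₂ · u₃) σ₂σ₃) + ((u₂ × n) · η₁) σ₂ (1 − (u₁ · u₃) σ₁σ₃)|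 ≥ 1/4; in particular this quantity is nonzero. -/
/-- Euclidean dot product on ℝ³. -/
def dot3 (v w : Fin 3 → ℝ) : ℝ := v 0 * w 0 + v 1 * w 1 + v 2 * w 2

/-- Cross product on ℝ³. -/
def cross3 (v w : Fin 3 → ℝ) : Fin 3 → ℝ :=
  ![v 1 * w 2 - v 2 * w 1, v 2 * w 0 - v 0 * w 2, v 0 * w 1 - v 1 * w 0]

/-- Euclidean norm on ℝ³. -/
noncomputable def norm3 (v : Fin 3 → ℝ) : ℝ := Real.sqrt (dot3 v v)

/-- Normalisation of a vector of ℝ³. -/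
noncomputable def unit3 (v : Fin 3 → ℝ) : Fin 3 → ℝ := fun i => v i / norm3 v

open Filter Topology

section Continuity

variable {X : Type*} [TopologicalSpace X] {f g : X → Fin 3 → ℝ} {x : X}

theorem ContinuousAt.dot3 (hf : ContinuousAt f x) (hg : ContinuousAt g x) :
    ContinuousAt (fun y => dot3 (f y) (g y)) x := by
  have hf' := continuousAt_pi.1 hf
  have hg' := continuousAt_pi.1 hg
  exact (((hf' 0).mul (hg' 0)).add ((hf' 1).mul (hg' 1))).add ((hf' 2).mul (hg' 2))

theorem ContinuousAt.cross3 (hf : ContinuousAt f x) (hg : ContinuousAt g x) :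
    ContinuousAt (fun y => cross3 (f y) (g y)) x := by
  have hf' := continuousAt_pi.1 hf
  have hg' := continuousAt_pi.1 hg
  refine continuousAt_pi.2 fun i => ?_
  fin_cases i
  · exact ((hf' 1).mul (hg' 2)).sub ((hf' 2).mul (hg' 1))
  · exact ((hf' 2).mul (hg' 0)).sub ((hf' 0).mul (hg' 2))
  · exact ((hf' 0).mul (hg' 1)).sub ((hf' 1).mul (hg' 0))

theorem ContinuousAt.unit3 (hf : ContinuousAt f x) (h : norm3 (f x) ≠ 0) :
    ContinuousAt (fun y => unit3 (f y)) x :=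
  continuousAt_pi.2 fun i =>
    ((continuous_apply i).continuousAt.comp hf).div (hf.dot3 hf).sqrt h

end Continuity

theorem abs_apply_le_norm3 (v : Fin 3 → ℝ) (i : Fin 3) : |v i| ≤ norm3 v := by
  refine Real.abs_le_sqrt ?_
  unfold dot3
  fin_cases i <;> simp <;> nlinarith [sq_nonneg (v 0), sq_nonneg (v 1), sq_nonneg (v 2)]

theorem dist_le_norm3_sub (v w : Fin 3 → ℝ) : dist v w ≤ norm3 (v - w) :=
  (dist_pi_le_iff (Real.sqrt_nonneg _)).2 fun i => abs_apply_le_norm3 (v - w) i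

/-- The quantity `((u₁ × n)·η₂) σ₁ (1 - (u₂·u₃) σ₂σ₃) + ((u₂ × n)·η₁) σ₂ (1 - (u₁·u₃) σ₁σ₃)`,
with `u_j` the normalisation of `η_j` and `n` that of `η₁ × η₂`. -/
noncomputable def cascadeSymbol (σ₁ σ₂ σ₃ : ℝ) (η₁ η₂ η₃ : Fin 3 → ℝ) : ℝ :=
  dot3 (cross3 (unit3 η₁) (unit3 (cross3 η₁ η₂))) η₂ * σ₁ *
      (1 - dot3 (unit3 η₂) (unit3 η₃) * σ₂ * σ₃) +
    dot3 (cross3 (unit3 η₂) (unit3 (cross3 η₁ η₂))) η₁ * σ₂ *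
      (1 - dot3 (unit3 η₁) (unit3 η₃) * σ₁ * σ₃)

theorem continuousAt_cascadeSymbol (σ₁ σ₂ σ₃ : ℝ) {η₁ η₂ η₃ : Fin 3 → ℝ}
    (h₁ : norm3 η₁ ≠ 0) (h₂ : norm3 η₂ ≠ 0) (h₃ : norm3 η₃ ≠ 0)
    (hn : norm3 (cross3 η₁ η₂) ≠ 0) :
    ContinuousAt (fun p : (Fin 3 → ℝ) × (Fin 3 → ℝ) × (Fin 3 → ℝ) =>
      cascadeSymbol σ₁ σ₂ σ₃ p.1 p.2.1 p.2.2) (η₁, η₂, η₃) := by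
  have c₁ : ContinuousAt (fun p : (Fin 3 → ℝ) × (Fin 3 → ℝ) × (Fin 3 → ℝ) => p.1)
    (η₁, η₂, η₃) := by fun_prop
  have c₂ : ContinuousAt (fun p : (Fin 3 → ℝ) × (Fin 3 → ℝ) × (Fin 3 → ℝ) => p.2.1)
    (η₁, η₂, η₃) := by fun_prop
  have c₃ : ContinuousAt (fun p : (Fin 3 → ℝ) × (Fin 3 → ℝ) × (Fin 3 → ℝ) => p.2.2)
    (η₁, η₂, η₃) := by fun_prop
  have u₁ := c₁.unit3 h₁
  have u₂ := c₂.unit3 h₂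
  have u₃ := c₃.unit3 h₃
  have n := (c₁.cross3 c₂).unit3 hn
  exact ((((u₁.cross3 n).dot3 c₂).mul_const σ₁).mul
      (continuousAt_const.sub (((u₂.dot3 u₃).mul_const σ₂).mul_const σ₃))).add
    ((((u₂.cross3 n).dot3 c₁).mul_const σ₂).mul
      (continuousAt_const.sub (((u₁.dot3 u₃).mul_const σ₁).mul_const σ₃)))

theorem cross3_base : cross3 ![0, 1, 0] ![-1, -1, 0] = ![0, 0, 1] := by
  simp [cross3]

theorem norm3_base₁ : norm3 ![0, 1, 0] = 1 := by simp [norm3, dot3]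

theorem norm3_base₂ : norm3 ![-1, -1, 0] = √2 := by simp [norm3, dot3, one_add_one_eq_two]

theorem norm3_base₃ : norm3 ![1, 0, 0] = 1 := by simp [norm3, dot3]

theorem norm3_base_normal : norm3 ![0, 0, 1] = 1 := by simp [norm3, dot3]

theorem cascadeSymbol_base (σ₁ σ₂ σ₃ : ℝ) :
    cascadeSymbol σ₁ σ₂ σ₃ ![0, 1, 0] ![-1, -1, 0] ![1, 0, 0] =
      -σ₁ * (1 + (√2)⁻¹ * σ₂ * σ₃) + (√2)⁻¹ * σ₂ := by
  simp [cascadeSymbol, cross3, dot3, unit3, norm3_base₁, norm3_base₂, norm3_base₃,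
    norm3_base_normal]
  ring

theorem quarter_lt_abs_cascadeSymbol_base {σ₁ σ₂ σ₃ : ℝ}
    (h₁ : σ₁ = 1 ∨ σ₁ = -1) (h₂ : σ₂ = 1 ∨ σ₂ = -1) (h₃ : σ₃ = 1 ∨ σ₃ = -1) :
    1 / 4 < |cascadeSymbol σ₁ σ₂ σ₃ ![0, 1, 0] ![-1, -1, 0] ![1, 0, 0]| := by
  rw [cascadeSymbol_base, lt_abs]
  have hpos : 0 < (√2)⁻¹ := by positivity
  have hsq : (√2)⁻¹ * (√2)⁻¹ = 1 / 2 := by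
    rw [← mul_inv, Real.mul_self_sqrt (by norm_num)]; norm_num
  have hlo : 5 / 8 < (√2)⁻¹ := by nlinarith
  rcases h₁ with rfl | rfl <;> rcases h₂ with rfl | rfl <;> rcases h₃ with rfl | rfl <;>
    first
      | (left; linarith)
      | (right; linarith)

theorem eventually_cascadeSymbol_nondegenerate :
    ∀ᶠ p : (Fin 3 → ℝ) × (Fin 3 → ℝ) × (Fin 3 → ℝ) in
        𝓝 (![0, 1, 0], ![-1, -1, 0], ![1, 0, 0]),
      cross3 p.1 p.2.1 ≠ 0 ∧
        ∀ σ₁ ∈ ({1, -1} : Set ℝ), ∀ σ₂ ∈ ({1, -1} : Set ℝ), ∀ σ₃ ∈ ({1, -1} : Set ℝ),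
          1 / 4 < |cascadeSymbol σ₁ σ₂ σ₃ p.1 p.2.1 p.2.2| := by
  have hfin : ({1, -1} : Set ℝ).Finite := Set.toFinite _
  refine Eventually.and ?_ ?_
  · have hc : ContinuousAt (fun p : (Fin 3 → ℝ) × (Fin 3 → ℝ) × (Fin 3 → ℝ) =>
        cross3 p.1 p.2.1) (![0, 1, 0], ![-1, -1, 0], ![1, 0, 0]) :=
      ContinuousAt.cross3 (by fun_prop) (by fun_prop)
    refine hc.eventually_ne ?_
    simp [cross3_base]
  · simp only [eventually_all_finite hfin]
    intro σ₁ h₁ σ₂ h₂ σ₃ h₃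
    refine (continuousAt_cascadeSymbol σ₁ σ₂ σ₃ ?_ ?_ ?_ ?_).abs.eventually_const_lt
      (quarter_lt_abs_cascadeSymbol_base h₁ h₂ h₃)
    · simp [norm3_base₁]
    · simp [norm3_base₂]
    · simp [norm3_base₃]
    · simp [cross3_base, norm3_base_normal]

/-- Non-degeneracy of the coefficients `c_{σ₁,σ₂,σ₃}`: for the base frequencies
`ξ₁⁰ = (0,1,0)`, `ξ₂⁰ = (-1,-1,0)`, `ξ₃⁰ = (1,0,0)` and any `C > 0`, if `ε₀` is small
enough then for any `η₁, η₂, η₃` within `C ε₀³` of the base frequencies summing to zero,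
the normal `n = (η₁ × η₂)/|η₁ × η₂|` is defined and for every choice of signs the
quantity `((u₁ × n)·η₂) σ₁ (1 - (u₂·u₃) σ₂σ₃) + ((u₂ × n)·η₁) σ₂ (1 - (u₁·u₃) σ₁σ₃)`
has absolute value at least `1/4`; in particular it is nonzero. -/
theorem cascade_symbol_nondegenerate (C : ℝ) (hC : 0 < C) :
    ∃ εstar : ℝ, 0 < εstar ∧
      ∀ ε₀ : ℝ, 0 < ε₀ → ε₀ ≤ εstar →
        ∀ η₁ η₂ η₃ : Fin 3 → ℝ,
          norm3 (η₁ - ![0, 1, 0]) < C * ε₀ ^ 3 →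
          norm3 (η₂ - ![-1, -1, 0]) < C * ε₀ ^ 3 →
          norm3 (η₃ - ![1, 0, 0]) < C * ε₀ ^ 3 →
          η₁ + η₂ + η₃ = 0 →
          cross3 η₁ η₂ ≠ 0 ∧
          ∀ σ₁ σ₂ σ₃ : ℝ,
            (σ₁ = 1 ∨ σ₁ = -1) → (σ₂ = 1 ∨ σ₂ = -1) → (σ₃ = 1 ∨ σ₃ = -1) →
            1 / 4 ≤
              |dot3 (cross3 (unit3 η₁) (unit3 (cross3 η₁ η₂))) η₂ * σ₁ *
                  (1 - dot3 (unit3 η₂) (unit3 η₃) * σ₂ * σ₃) +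
                dot3 (cross3 (unit3 η₂) (unit3 (cross3 η₁ η₂))) η₁ * σ₂ *
                  (1 - dot3 (unit3 η₁) (unit3 η₃) * σ₁ * σ₃)| ∧
            dot3 (cross3 (unit3 η₁) (unit3 (cross3 η₁ η₂))) η₂ * σ₁ *
                (1 - dot3 (unit3 η₂) (unit3 η₃) * σ₂ * σ₃) +
              dot3 (cross3 (unit3 η₂) (unit3 (cross3 η₁ η₂))) η₁ * σ₂ *
                (1 - dot3 (unit3 η₁) (unit3 η₃) * σ₁ * σ₃) ≠ 0 := by
  obtain ⟨δ, hδ, H⟩ := Metric.eventually_nhds_iff.1 eventually_cascadeSymbol_nondegenerate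
  refine ⟨min 1 (δ / C), lt_min one_pos (div_pos hδ hC), fun ε hε hle η₁ η₂ η₃ h₁ h₂ h₃ _ => ?_⟩
  have hε_le : C * ε ^ 3 ≤ δ := by
    have h := (le_div_iff₀' hC).1 (hle.trans (min_le_right _ _))
    have h' : ε ^ 3 ≤ ε := pow_le_of_le_one hε.le (hle.trans (min_le_left _ _)) three_ne_zero
    exact (mul_le_mul_of_nonneg_left h' hC.le).trans h
  have hdist {v w : Fin 3 → ℝ} (h : norm3 (v - w) < C * ε ^ 3) : dist v w < δ :=
    (dist_le_norm3_sub v w).trans_lt (h.trans_le hε_le)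
  obtain ⟨hn, hσ⟩ := H (y := (η₁, η₂, η₃))
    (max_lt (hdist h₁) (max_lt (hdist h₂) (hdist h₃)))
  refine ⟨hn, fun σ₁ σ₂ σ₃ s₁ s₂ s₃ => ?_⟩
  have h := hσ σ₁ s₁ σ₂ s₂ σ₃ s₃
  exact ⟨h.le, abs_pos.1 (lt_trans (by norm_num) h)⟩
end
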